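/- arXiv:2305.11829 — 2 statements merged into one kernel-verified Lean document; each statement's English description precedes it below -/
import Mathlib

section
/- Let Φ_E be a regular Gauss IFS with conformal dimension δ = δ_E and conformal measure μ, satisfying Assumptions 1, C (with constant λ > 1), and 3. Let ψ be a doubling dimension function with Ψ(r) = r^{-δ}ψ(r) decreasing, and define J_{k,α,1} as below. If ∑_{k=1}^∞ μ(J_{k,α,1}) converges for all α > 0, then H^ψ(μ) = ∞; if it diverges for all α > 0, then H^ψ(μ) = 0; otherwise (converges for some α > 0 and diverges for others) H^ψ(μ) is positive and finite. -/
open MeasureTheory Metric Filter Set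
open scoped ENNReal Topology NNReal

noncomputable section

/-- The Gauss map `φ_a(x) = 1/(a+x)`. -/
def gaussMap (a : ℕ) (x : ℝ) : ℝ := 1 / (a + x)

/-- `φ_ω = φ_{ω₁} ∘ ⋯ ∘ φ_{ω_n}` for a finite word `ω`. -/
def wordMap : List ℕ → ℝ → ℝ
  | [] => fun x => x
  | a :: ω => fun x => gaussMap a (wordMap ω x)

/-- `‖φ_ω'‖ = sup_{x ∈ [0,1]} |φ_ω'(x)|`. -/
def derivNorm (ω : List ℕ) : ℝ := ⨆ x : Icc (0 : ℝ) 1, |deriv (wordMap ω) (x : ℝ)|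

/-- The cylinder `[ω] = φ_ω([0,1])`. -/
def cyl (ω : List ℕ) : Set ℝ := wordMap ω '' Icc 0 1

/-- The set of finite words over the alphabet `E`. -/
def words (E : Set ℕ) : Set (List ℕ) := {ω | ∀ a ∈ ω, a ∈ E}

/-- The coding map `π(ω) = [0; ω₀, ω₁, …]`. -/
def codingMap (ω : ℕ → ℕ) : ℝ :=
  limUnder atTop fun n => wordMap (List.ofFn fun i : Fin n => ω i) 0

/-- The limit set `Λ_E`. -/
def limitSet (E : Set ℕ) : Set ℝ := codingMap '' {ω | ∀ n, ω n ∈ E}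

/-- The pressure function of the Gauss IFS on the alphabet `E`. -/
def pressure (E : Set ℕ) (s : ℝ) : ℝ :=
  limUnder atTop fun n : ℕ =>
    (n : ℝ)⁻¹ * Real.log (∑' ω : Fin n → E, derivNorm (List.ofFn fun i => (ω i : ℕ)) ^ s)

/-- `μ` is the `δ`-conformal measure of the Gauss IFS on the alphabet `E`. -/
def IsConformal (E : Set ℕ) (δ : ℝ) (μ : Measure ℝ) : Prop :=
  IsProbabilityMeasure μ ∧ μ (limitSet E)ᶜ = 0 ∧
    ∀ A : Set ℝ, A ⊆ Icc 0 1 → MeasurableSet A →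
      μ A = ∑' a : E, ENNReal.ofReal (∫ x in gaussMap (a : ℕ) ⁻¹' A, |deriv (gaussMap (a : ℕ)) x| ^ δ ∂μ)

/-- The set of prime numbers. -/
def primes : Set ℕ := {p | p.Prime}

/-- `μ(J) = ∑_{a ∈ J} μ([a])` for a set of letters `J`. -/
def cylMass (μ : Measure ℝ) (J : Set ℕ) : ℝ≥0∞ := ∑' a : J, μ (cyl [(a : ℕ)])

/-- A dimension function: continuous, increasing, positive, with `ψ(0⁺) = 0`. -/
def IsDimFun (ψ : ℝ → ℝ) : Prop :=
  ContinuousOn ψ (Ioi 0) ∧ MonotoneOn ψ (Ioi 0) ∧ (∀ r : ℝ, 0 < r → 0 < ψ r) ∧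
    Tendsto ψ (𝓝[>] (0 : ℝ)) (𝓝 0)

/-- A doubling function. -/
def IsDoubling (ψ : ℝ → ℝ) : Prop :=
  ∀ C₁ : ℝ, 1 ≤ C₁ → ∃ C₂ : ℝ, 1 ≤ C₂ ∧ ∀ x y : ℝ, 0 < x → 0 < y →
    C₁⁻¹ ≤ x / y → x / y ≤ C₁ → C₂⁻¹ ≤ ψ x / ψ y ∧ ψ x / ψ y ≤ C₂

open Classical in
/-- The `ψ`-dimensional Hausdorff measure `H^ψ`. -/
def hausdorffPsi (ψ : ℝ → ℝ) : Measure ℝ :=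
  Measure.mkMetric fun d => if d = 0 then 0 else ENNReal.ofReal (ψ d.toReal)

/-- `H^ψ(μ) = inf {H^ψ(A) : A Borel, μ(ℝ∖A) = 0}`. -/
def hausdorffPsiOf (ψ : ℝ → ℝ) (μ : Measure ℝ) : ℝ≥0∞ :=
  ⨅ (A : Set ℝ) (_ : MeasurableSet A) (_ : μ Aᶜ = 0), hausdorffPsi ψ A

/-- The `ψ`-dimensional packing pre-measure `P̃^ψ`. -/
def packingPre (ψ : ℝ → ℝ) (A : Set ℝ) : ℝ≥0∞ :=
  ⨅ (ε : ℝ) (_ : 0 < ε),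
    ⨆ (D : Set (ℝ × ℝ)) (_ : D.Countable)
      (_ : ∀ p ∈ D, p.1 ∈ A ∧ 0 < p.2 ∧ 2 * p.2 ≤ ε)
      (_ : D.PairwiseDisjoint fun p => closedBall p.1 p.2),
      ∑' p : D, ENNReal.ofReal (ψ (2 * (p : ℝ × ℝ).2))

/-- The `ψ`-dimensional packing measure `P^ψ`. -/
def packingPsi (ψ : ℝ → ℝ) (A : Set ℝ) : ℝ≥0∞ :=
  ⨅ (S : ℕ → Set ℝ) (_ : A ⊆ ⋃ i, S i), ∑' i, packingPre ψ (S i)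

/-- `P^ψ(μ) = inf {P^ψ(A) : A Borel, μ(ℝ∖A) = 0}`. -/
def packingPsiOf (ψ : ℝ → ℝ) (μ : Measure ℝ) : ℝ≥0∞ :=
  ⨅ (A : Set ℝ) (_ : MeasurableSet A) (_ : μ Aᶜ = 0), packingPsi ψ A

/-- Assumption C with constant `λ`: `μ({a : λ⁻¹r < ‖φ_a'‖ ≤ r}) ≍ μ({a : ‖φ_a'‖ ≤ r})`. -/
def AssumptionC (E : Set ℕ) (μ : Measure ℝ) (lam : ℝ) : Prop :=
  ∃ c C : ℝ≥0∞, 0 < c ∧ C ≠ ⊤ ∧ ∀ r : ℝ, 0 < r → r ≤ 1 →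
    c * cylMass μ {a ∈ E | derivNorm [a] ≤ r} ≤
        cylMass μ {a ∈ E | lam⁻¹ * r < derivNorm [a] ∧ derivNorm [a] ≤ r} ∧
      cylMass μ {a ∈ E | lam⁻¹ * r < derivNorm [a] ∧ derivNorm [a] ≤ r} ≤
        C * cylMass μ {a ∈ E | derivNorm [a] ≤ r}

/-- `f` is regularly varying with exponent `s`. -/
def RegVarying (f : ℝ → ℝ) (s : ℝ) : Prop :=
  ∀ a : ℝ, 1 < a → Tendsto (fun x => f (a * x) / f x) atTop (𝓝 (a ^ s))

/-- Assumption 1: `#(E ∩ [N,2N]) ≍ f(N)`. -/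
def Assumption1 (E : Set ℕ) (f : ℝ → ℝ) : Prop :=
  ∃ c C : ℝ, 0 < c ∧ 0 < C ∧ ∀ N : ℕ, 1 ≤ N →
    c * f N ≤ ((E ∩ Icc N (2 * N)).ncard : ℝ) ∧ ((E ∩ Icc N (2 * N)).ncard : ℝ) ≤ C * f N

/-- Assumption 3: the Lyapunov exponent `-∑_{a∈E} μ(a) log ‖φ_a'‖` is finite. -/
def Assumption3 (E : Set ℕ) (μ : Measure ℝ) : Prop :=
  Summable fun a : E => (μ (cyl [(a : ℕ)])).toReal * Real.log (derivNorm [(a : ℕ)])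

/-- `W_k = {ω : λ^{-(k+1)} < ‖φ_ω'‖ ≤ λ^{-k}}`. -/
def W (lam : ℝ) (k : ℕ) : Set (List ℕ) :=
  {ω | lam ^ (-(k : ℝ) - 1) < derivNorm ω ∧ derivNorm ω ≤ lam ^ (-(k : ℝ))}

/-- `A_k = ⋃ {[ωa] : ω ∈ W_k ∩ E^*, a ∈ J}`. -/
def cylUnion (E : Set ℕ) (lam : ℝ) (k : ℕ) (J : Set ℕ) : Set ℝ :=
  ⋃ ω ∈ W lam k ∩ words E, ⋃ a ∈ J, cyl (ω ++ [a])

/-- `S_J`: sequences in `E^ℕ` with infinitely many `(n,k)` such that `ω|n ∈ W_k`, `ω_{n+1} ∈ J_k`. -/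
def Sset (E : Set ℕ) (lam : ℝ) (J : ℕ → Set ℕ) : Set (ℕ → ℕ) :=
  {ω | (∀ n, ω n ∈ E) ∧
    {p : ℕ × ℕ | (List.ofFn fun i : Fin p.1 => ω i) ∈ W lam p.2 ∧ ω p.1 ∈ J p.2}.Infinite}

/-- The upper density `D̄^ψ_μ(x)`. -/
def upperDensity (ψ : ℝ → ℝ) (μ : Measure ℝ) (x : ℝ) : ℝ≥0∞ :=
  limsup (fun r => μ (closedBall x r) / ENNReal.ofReal (ψ r)) (𝓝[>] (0 : ℝ))

/-- The lower density `D̲^ψ_μ(x)`. -/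
def lowerDensity (ψ : ℝ → ℝ) (μ : Measure ℝ) (x : ℝ) : ℝ≥0∞ :=
  liminf (fun r => μ (closedBall x r) / ENNReal.ofReal (ψ r)) (𝓝[>] (0 : ℝ))

/-- `J_{k,α,1} = {a ∈ E : ∃ r ∈ [‖φ_a'‖,1], r^{-δ} μ(B([a],r)) ≥ α Ψ(λ^{-k} r)}`. -/
def JsetH (E : Set ℕ) (δ : ℝ) (μ : Measure ℝ) (Ψ : ℝ → ℝ) (lam : ℝ) (k : ℕ) (α : ℝ) : Set ℕ :=
  {a ∈ E | ∃ r : ℝ, derivNorm [a] ≤ r ∧ r ≤ 1 ∧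
    ENNReal.ofReal (α * r ^ δ * Ψ (lam ^ (-(k : ℝ)) * r)) ≤ μ (cthickening r (cyl [a]))}

/-- `J_{k,α,-1} = {a ∈ E : ∃ r ∈ [‖φ_a'‖,1], r^{-δ} μ(B([a],r)) ≤ α Ψ(λ^{-k} r)}`. -/
def JsetP (E : Set ℕ) (δ : ℝ) (μ : Measure ℝ) (Ψ : ℝ → ℝ) (lam : ℝ) (k : ℕ) (α : ℝ) : Set ℕ :=
  {a ∈ E | ∃ r : ℝ, derivNorm [a] ≤ r ∧ r ≤ 1 ∧
    μ (cthickening r (cyl [a])) ≤ ENNReal.ofReal (α * r ^ δ * Ψ (lam ^ (-(k : ℝ)) * r))}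

/-- `S_{α,1}`. -/
def SsetH (E : Set ℕ) (δ : ℝ) (μ : Measure ℝ) (Ψ : ℝ → ℝ) (lam : ℝ) (α : ℝ) : Set (ℕ → ℕ) :=
  {ω | {p : ℕ × ℕ | (List.ofFn fun i : Fin p.1 => ω i) ∈ W lam p.2 ∧
    ω p.1 ∈ JsetH E δ μ Ψ lam p.2 α}.Infinite}

/-- `S_{α,-1}`. -/
def SsetP (E : Set ℕ) (δ : ℝ) (μ : Measure ℝ) (Ψ : ℝ → ℝ) (lam : ℝ) (α : ℝ) : Set (ℕ → ℕ) :=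
  {ω | {p : ℕ × ℕ | (List.ofFn fun i : Fin p.1 => ω i) ∈ W lam p.2 ∧
    ω p.1 ∈ JsetP E δ μ Ψ lam p.2 α}.Infinite}

/-- `M(x,pre,r) = ∑_{a ∈ E, [pre·a] ⊆ B(x,r)} μ([pre·a])`. -/
def Mform (E : Set ℕ) (μ : Measure ℝ) (x : ℝ) (pre : List ℕ) (r : ℝ) : ℝ≥0∞ :=
  ∑' a : {a : ℕ // a ∈ E ∧ cyl (pre ++ [a]) ⊆ closedBall x r}, μ (cyl (pre ++ [(a : ℕ)]))

/-- A word all of whose letters are positive. -/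
def PosWord (σ : List ℕ) : Prop := ∀ a ∈ σ, 1 ≤ a

/-- Homogeneous coordinates (numerator, denominator) of `φ_σ(x)`. -/
def homCoord (x : ℝ) : List ℕ → ℝ × ℝ
  | [] => (x, 1)
  | a :: σ => ((homCoord x σ).2, a * (homCoord x σ).2 + (homCoord x σ).1)

/-- The denominator of `φ_σ(x)`; one has `|φ_σ'(x)| = (wordDen σ x)⁻²`. -/
def wordDen (σ : List ℕ) (x : ℝ) : ℝ := (homCoord x σ).2

/-- The numerator of `φ_σ(x)`. -/
def wordNum (σ : List ℕ) (x : ℝ) : ℝ := (homCoord x σ).1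

@[simp] lemma wordDen_nil (x : ℝ) : wordDen [] x = 1 := rfl
@[simp] lemma wordNum_nil (x : ℝ) : wordNum [] x = x := rfl
lemma wordDen_cons (a : ℕ) (σ : List ℕ) (x : ℝ) :
    wordDen (a :: σ) x = a * wordDen σ x + wordNum σ x := rfl
lemma wordNum_cons (a : ℕ) (σ : List ℕ) (x : ℝ) : wordNum (a :: σ) x = wordDen σ x := rfl

lemma PosWord.of_cons {a : ℕ} {σ : List ℕ} (h : PosWord (a :: σ)) :
    (1 : ℝ) ≤ a ∧ PosWord σ :=
  ⟨by exact_mod_cast h a (by simp), fun b hb => h b (by simp [hb])⟩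

lemma PosWord.append {σ τ : List ℕ} (h : PosWord σ) (h' : PosWord τ) : PosWord (σ ++ τ) := by
  intro a ha
  rcases List.mem_append.1 ha with ha | ha
  exacts [h a ha, h' a ha]

lemma posWord_singleton {a : ℕ} (h : 1 ≤ a) : PosWord [a] := by
  intro b hb
  simp at hb
  omega

lemma wordNum_nonneg_and_one_le_wordDen {σ : List ℕ} (h : PosWord σ) {x : ℝ} (hx : 0 ≤ x) :
    0 ≤ wordNum σ x ∧ 1 ≤ wordDen σ x := by
  induction σ with
  | nil => simp [hx]
  | cons a σ ih =>
    obtain ⟨ha, hσ⟩ := h.of_cons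
    obtain ⟨h1, h2⟩ := ih hσ
    rw [wordNum_cons, wordDen_cons]
    exact ⟨by linarith, by nlinarith⟩

lemma one_le_wordDen {σ : List ℕ} (h : PosWord σ) {x : ℝ} (hx : 0 ≤ x) : 1 ≤ wordDen σ x :=
  (wordNum_nonneg_and_one_le_wordDen h hx).2

lemma wordMap_eq_div {σ : List ℕ} (h : PosWord σ) {x : ℝ} (hx : 0 ≤ x) :
    wordMap σ x = wordNum σ x / wordDen σ x := by
  induction σ with
  | nil => simp [wordMap]
  | cons a σ ih =>
    obtain ⟨ha, hσ⟩ := h.of_cons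
    obtain ⟨h1, h2⟩ := wordNum_nonneg_and_one_le_wordDen hσ hx
    change 1 / (a + wordMap σ x) = _
    rw [ih hσ, wordNum_cons, wordDen_cons]
    have : wordDen σ x ≠ 0 := by linarith
    field_simp

lemma wordMap_nonneg {σ : List ℕ} (h : PosWord σ) {x : ℝ} (hx : 0 ≤ x) : 0 ≤ wordMap σ x := by
  obtain ⟨h1, h2⟩ := wordNum_nonneg_and_one_le_wordDen h hx
  rw [wordMap_eq_div h hx]
  positivity

lemma gaussMap_mem_Icc {a : ℕ} (ha : 1 ≤ a) {x : ℝ} (hx : x ∈ Icc (0 : ℝ) 1) :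
    gaussMap a x ∈ Icc (0 : ℝ) 1 := by
  have ha' : (1 : ℝ) ≤ a := by exact_mod_cast ha
  have := hx.1
  refine ⟨by unfold gaussMap; positivity, ?_⟩
  unfold gaussMap
  rw [div_le_one (by linarith)]
  linarith

lemma wordMap_mem_Icc {σ : List ℕ} (h : PosWord σ) {x : ℝ} (hx : x ∈ Icc (0 : ℝ) 1) :
    wordMap σ x ∈ Icc (0 : ℝ) 1 := by
  induction σ with
  | nil => simpa [wordMap] using hx
  | cons a σ ih => exact gaussMap_mem_Icc (h a (by simp)) (ih h.of_cons.2)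

lemma wordMap_append (σ τ : List ℕ) (x : ℝ) :
    wordMap (σ ++ τ) x = wordMap σ (wordMap τ x) := by
  induction σ with
  | nil => rfl
  | cons a σ ih => exact congrArg (gaussMap a) ih

lemma wordMap_singleton (a : ℕ) (x : ℝ) : wordMap [a] x = gaussMap a x := rfl

lemma homCoord_append {τ : List ℕ} (hτ : PosWord τ) {x : ℝ} (hx : 0 ≤ x) (σ : List ℕ) :
    wordNum (σ ++ τ) x = wordDen τ x * wordNum σ (wordMap τ x) ∧
      wordDen (σ ++ τ) x = wordDen τ x * wordDen σ (wordMap τ x) := by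
  induction σ with
  | nil =>
    have := one_le_wordDen hτ hx
    simp only [List.nil_append, wordNum_nil, wordDen_nil, mul_one, and_true]
    rw [wordMap_eq_div hτ hx]
    field_simp
  | cons a σ ih =>
    rw [List.cons_append, wordNum_cons, wordDen_cons, wordNum_cons, wordDen_cons, ih.1, ih.2]
    exact ⟨rfl, by ring⟩

lemma wordDen_append {τ : List ℕ} (hτ : PosWord τ) {x : ℝ} (hx : 0 ≤ x) (σ : List ℕ) :
    wordDen (σ ++ τ) x = wordDen τ x * wordDen σ (wordMap τ x) := (homCoord_append hτ hx σ).2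

lemma wordDen_distortion {σ : List ℕ} (h : PosWord σ) {x : ℝ} (hx : x ∈ Icc (0 : ℝ) 1) :
    wordDen σ 0 ≤ wordDen σ x ∧ wordDen σ x ≤ 2 * wordDen σ 0 := by
  suffices H : wordNum σ 0 ≤ wordNum σ x ∧ wordDen σ 0 ≤ wordDen σ x ∧
      wordDen σ x ≤ 2 * wordDen σ 0 ∧
      wordDen σ x + wordNum σ x ≤ 2 * (wordDen σ 0 + wordNum σ 0) from ⟨H.2.1, H.2.2.1⟩
  induction σ with
  | nil => simpa [hx.1] using (by linarith [hx.2] : 1 + x ≤ 2)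
  | cons a σ ih =>
    obtain ⟨ha, hσ⟩ := h.of_cons
    obtain ⟨h1, h2, h3, h4⟩ := ih hσ
    simp only [wordNum_cons, wordDen_cons]
    exact ⟨h2, by nlinarith, by nlinarith, by nlinarith⟩

lemma abs_wordNum_mul_wordDen_sub (σ : List ℕ) (x y : ℝ) :
    |wordNum σ x * wordDen σ y - wordNum σ y * wordDen σ x| = |x - y| := by
  induction σ with
  | nil => simp
  | cons a σ ih =>
    simp only [wordNum_cons, wordDen_cons]
    rw [← ih, ← abs_neg]
    congr 1
    ring

lemma abs_wordMap_sub {σ : List ℕ} (h : PosWord σ) {x y : ℝ} (hx : 0 ≤ x) (hy : 0 ≤ y) :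
    |wordMap σ x - wordMap σ y| = |x - y| / (wordDen σ x * wordDen σ y) := by
  have h1 := one_le_wordDen h hx
  have h2 := one_le_wordDen h hy
  rw [wordMap_eq_div h hx, wordMap_eq_div h hy, div_sub_div _ _ (by linarith) (by linarith),
    abs_div, ← abs_wordNum_mul_wordDen_sub σ x y, abs_of_pos (a := wordDen σ x * wordDen σ y)
    (by positivity)]
  congr 2
  ring

lemma hasDerivAt_wordMap {σ : List ℕ} (h : PosWord σ) {x : ℝ} (hx : 0 ≤ x) :
    ∃ d : ℝ, HasDerivAt (wordMap σ) d x ∧ |d| = 1 / wordDen σ x ^ 2 := by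
  induction σ with
  | nil => exact ⟨1, hasDerivAt_id x, by simp⟩
  | cons a σ ih =>
    obtain ⟨ha, hσ⟩ := h.of_cons
    obtain ⟨d, hd, hd'⟩ := ih hσ
    have h0 := wordMap_nonneg hσ hx
    have h1 := one_le_wordDen hσ hx
    have hpos : (0 : ℝ) < a + wordMap σ x := by linarith
    refine ⟨-d / (a + wordMap σ x) ^ 2, ?_, ?_⟩
    · have := ((hd.const_add (a : ℝ)).inv hpos.ne')
      refine this.congr_of_eventuallyEq (Eventually.of_forall fun y => ?_)
      simp [wordMap, gaussMap]
    · rw [abs_div, abs_neg, hd', abs_of_pos (by positivity : (0 : ℝ) < (a + wordMap σ x) ^ 2),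
        wordDen_cons, wordMap_eq_div hσ hx]
      have : wordDen σ x ≠ 0 := by linarith
      field_simp

lemma abs_deriv_wordMap {σ : List ℕ} (h : PosWord σ) {x : ℝ} (hx : 0 ≤ x) :
    |deriv (wordMap σ) x| = 1 / wordDen σ x ^ 2 := by
  obtain ⟨d, hd, hd'⟩ := hasDerivAt_wordMap h hx
  rw [hd.deriv, hd']

lemma derivNorm_eq {σ : List ℕ} (h : PosWord σ) : derivNorm σ = 1 / wordDen σ 0 ^ 2 := by
  have h0 := one_le_wordDen h le_rfl
  have hle : ∀ x : Icc (0 : ℝ) 1, |deriv (wordMap σ) (x : ℝ)| ≤ 1 / wordDen σ 0 ^ 2 := by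
    intro x
    rw [abs_deriv_wordMap h x.2.1]
    have := (wordDen_distortion h x.2).1
    gcongr
  refine le_antisymm (ciSup_le hle) ?_
  rw [← abs_deriv_wordMap h le_rfl]
  exact le_ciSup (f := fun x : Icc (0 : ℝ) 1 => |deriv (wordMap σ) (x : ℝ)|)
    ⟨_, by rintro _ ⟨x, rfl⟩; exact hle x⟩ ⟨0, by simp⟩

lemma derivNorm_pos {σ : List ℕ} (h : PosWord σ) : 0 < derivNorm σ := by
  have h0 := one_le_wordDen h le_rfl
  rw [derivNorm_eq h]
  positivity

lemma derivNorm_singleton {a : ℕ} (ha : 1 ≤ a) : derivNorm [a] = 1 / (a : ℝ) ^ 2 := by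
  rw [derivNorm_eq (posWord_singleton ha)]
  simp [wordDen_cons]

lemma derivNorm_le_one {σ : List ℕ} (h : PosWord σ) : derivNorm σ ≤ 1 := by
  have h0 := one_le_wordDen h le_rfl
  rw [derivNorm_eq h, div_le_one (by positivity)]
  nlinarith

lemma derivNorm_append_le {σ τ : List ℕ} (hσ : PosWord σ) (hτ : PosWord τ) :
    derivNorm (σ ++ τ) ≤ derivNorm σ * derivNorm τ := by
  have h1 := one_le_wordDen hτ le_rfl
  have h2 := one_le_wordDen hσ le_rfl
  have h3 := (wordDen_distortion hσ (wordMap_mem_Icc hτ (x := 0) (by simp))).1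
  rw [derivNorm_eq (hσ.append hτ), derivNorm_eq hσ, derivNorm_eq hτ, wordDen_append hτ le_rfl,
    one_div_mul_one_div, ← mul_pow, mul_comm (wordDen σ 0)]
  gcongr

lemma le_derivNorm_append {σ τ : List ℕ} (hσ : PosWord σ) (hτ : PosWord τ) :
    derivNorm σ * derivNorm τ / 4 ≤ derivNorm (σ ++ τ) := by
  have h1 := one_le_wordDen hτ le_rfl
  have h2 := one_le_wordDen hσ le_rfl
  have h4 := one_le_wordDen hσ (wordMap_mem_Icc hτ (x := 0) (by simp)).1
  have h3 := (wordDen_distortion hσ (wordMap_mem_Icc hτ (x := 0) (by simp))).2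
  have : derivNorm σ * derivNorm τ / 4 = 1 / (wordDen τ 0 * (2 * wordDen σ 0)) ^ 2 := by
    rw [derivNorm_eq hσ, derivNorm_eq hτ]
    field_simp
    norm_num
  rw [this, derivNorm_eq (hσ.append hτ), wordDen_append hτ le_rfl]
  gcongr

lemma derivNorm_append_le_left {σ τ : List ℕ} (hσ : PosWord σ) (hτ : PosWord τ) :
    derivNorm (σ ++ τ) ≤ derivNorm σ :=
  (derivNorm_append_le hσ hτ).trans
    (mul_le_of_le_one_right (derivNorm_pos hσ).le (derivNorm_le_one hτ))

lemma abs_wordMap_sub_le {σ : List ℕ} (h : PosWord σ) {x y : ℝ} (hx : x ∈ Icc (0 : ℝ) 1)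
    (hy : y ∈ Icc (0 : ℝ) 1) : |wordMap σ x - wordMap σ y| ≤ derivNorm σ * |x - y| := by
  have h0 := one_le_wordDen h le_rfl
  have h1 := (wordDen_distortion h hx).1
  have h2 := (wordDen_distortion h hy).1
  rw [abs_wordMap_sub h hx.1 hy.1, derivNorm_eq h, one_div_mul_eq_div, sq]
  have h3 : 0 ≤ wordDen σ x := by linarith
  gcongr

lemma le_abs_wordMap_sub {σ : List ℕ} (h : PosWord σ) {x y : ℝ} (hx : x ∈ Icc (0 : ℝ) 1)
    (hy : y ∈ Icc (0 : ℝ) 1) : derivNorm σ / 4 * |x - y| ≤ |wordMap σ x - wordMap σ y| := by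
  have h0 := one_le_wordDen h le_rfl
  have h1 := wordDen_distortion h hx
  have h2 := wordDen_distortion h hy
  have : derivNorm σ / 4 * |x - y| = |x - y| / ((2 * wordDen σ 0) * (2 * wordDen σ 0)) := by
    rw [derivNorm_eq h]
    field_simp
    ring
  rw [this, abs_wordMap_sub h hx.1 hy.1]
  have h3 : 0 < wordDen σ x := by linarith
  have h4 : 0 < wordDen σ y := by linarith
  gcongr
  exacts [h1.2, h2.2]

lemma injOn_wordMap {σ : List ℕ} (h : PosWord σ) : InjOn (wordMap σ) (Icc 0 1) := by
  intro x hx y hy hxy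
  have h1 := le_abs_wordMap_sub h hx hy
  rw [hxy, sub_self, abs_zero] at h1
  have h2 := derivNorm_pos h
  have : |x - y| = 0 := le_antisymm (by
    by_contra! hc
    nlinarith [mul_pos h2 hc]) (abs_nonneg _)
  linarith [abs_eq_zero.1 this]

lemma continuousOn_wordMap {σ : List ℕ} (h : PosWord σ) : ContinuousOn (wordMap σ) (Icc 0 1) := by
  intro x hx
  obtain ⟨d, hd, -⟩ := hasDerivAt_wordMap h hx.1
  exact hd.continuousAt.continuousWithinAt

lemma two_mul_wordDen_le (a b : ℕ) {σ : List ℕ} (h : PosWord (a :: b :: σ)) :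
    2 * wordDen σ 0 ≤ wordDen (a :: b :: σ) 0 := by
  obtain ⟨ha, hbσ⟩ := h.of_cons
  obtain ⟨hb, hσ⟩ := hbσ.of_cons
  obtain ⟨h1, h2⟩ := wordNum_nonneg_and_one_le_wordDen hσ (le_refl (0 : ℝ))
  simp only [wordDen_cons, wordNum_cons]
  have h3 : 1 * wordDen σ 0 ≤ b * wordDen σ 0 := by gcongr
  have h4 : 1 * (b * wordDen σ 0 + wordNum σ 0) ≤ a * (b * wordDen σ 0 + wordNum σ 0) := by
    have : 0 ≤ b * wordDen σ 0 + wordNum σ 0 := by linarith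
    gcongr
  linarith

lemma derivNorm_le_half_pow {σ : List ℕ} (h : PosWord σ) :
    derivNorm σ ≤ 2 * (1 / 2 : ℝ) ^ σ.length := by
  induction σ using List.twoStepInduction with
  | nil => linarith [derivNorm_le_one h, (by simp : 2 * (1 / 2 : ℝ) ^ ([] : List ℕ).length = 2)]
  | singleton a => linarith [derivNorm_le_one h, (by simp : 2 * (1 / 2 : ℝ) ^ ([a]).length = 1)]
  | cons_cons a b σ ih _ =>
    have hσ := h.of_cons.2.of_cons.2
    have h1 := two_mul_wordDen_le a b h
    have h2 := one_le_wordDen hσ le_rfl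
    have h3 : derivNorm (a :: b :: σ) ≤ derivNorm σ / 4 := by
      rw [derivNorm_eq h, derivNorm_eq hσ, div_div]
      gcongr
      nlinarith
    have h4 := ih hσ
    simp only [List.length_cons, pow_succ]
    linarith

/-- The first `n` letters of `ω`. -/
def wordPrefix (ω : ℕ → ℕ) (n : ℕ) : List ℕ := List.ofFn fun i : Fin n => ω i

lemma wordPrefix_zero (ω : ℕ → ℕ) : wordPrefix ω 0 = [] := rfl

lemma wordPrefix_succ (ω : ℕ → ℕ) (n : ℕ) : wordPrefix ω (n + 1) = wordPrefix ω n ++ [ω n] := by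
  rw [wordPrefix, List.ofFn_succ_last]
  rfl

lemma wordPrefix_succ_cons (ω : ℕ → ℕ) (n : ℕ) :
    wordPrefix ω (n + 1) = ω 0 :: wordPrefix (fun i => ω (i + 1)) n := by
  simp [wordPrefix, List.ofFn_succ]

lemma length_wordPrefix (ω : ℕ → ℕ) (n : ℕ) : (wordPrefix ω n).length = n := by
  simp [wordPrefix]

lemma posWord_wordPrefix {ω : ℕ → ℕ} (h : ∀ n, 1 ≤ ω n) (n : ℕ) : PosWord (wordPrefix ω n) := by
  intro a ha
  obtain ⟨i, rfl⟩ := List.mem_ofFn.1 ha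
  exact h _

lemma tendsto_codingMap {ω : ℕ → ℕ} (h : ∀ n, 1 ≤ ω n) :
    Tendsto (fun n => wordMap (wordPrefix ω n) 0) atTop (𝓝 (codingMap ω)) := by
  refine CauchySeq.tendsto_limUnder (cauchySeq_of_le_geometric (1 / 2 : ℝ) 2 (by norm_num) ?_)
  intro n
  rw [wordPrefix_succ, wordMap_append, Real.dist_eq]
  have h0 : (0 : ℝ) ∈ Icc (0 : ℝ) 1 := by simp
  have h1 : wordMap [ω n] 0 ∈ Icc (0 : ℝ) 1 := wordMap_mem_Icc (posWord_singleton (h n)) h0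
  have h2 := derivNorm_le_half_pow (posWord_wordPrefix h n)
  rw [length_wordPrefix] at h2
  refine (abs_wordMap_sub_le (posWord_wordPrefix h n) h0 h1).trans ?_
  refine (mul_le_of_le_one_right (derivNorm_pos (posWord_wordPrefix h n)).le ?_).trans h2
  rw [zero_sub, abs_neg, abs_of_nonneg h1.1]
  exact h1.2

lemma codingMap_mem_Icc {ω : ℕ → ℕ} (h : ∀ n, 1 ≤ ω n) : codingMap ω ∈ Icc (0 : ℝ) 1 :=
  isClosed_Icc.mem_of_tendsto (tendsto_codingMap h) (Eventually.of_forall fun n =>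
    wordMap_mem_Icc (posWord_wordPrefix h n) (by simp))

lemma codingMap_eq_gaussMap {ω : ℕ → ℕ} (h : ∀ n, 1 ≤ ω n) :
    codingMap ω = gaussMap (ω 0) (codingMap fun i => ω (i + 1)) := by
  have h' : ∀ n, 1 ≤ ω (n + 1) := fun n => h (n + 1)
  refine tendsto_nhds_unique ((tendsto_add_atTop_iff_nat 1).2 (tendsto_codingMap h)) ?_
  simp_rw [wordPrefix_succ_cons]
  have hc : ContinuousAt (gaussMap (ω 0)) (codingMap fun i => ω (i + 1)) :=
    (hasDerivAt_wordMap (posWord_singleton (h 0)) (codingMap_mem_Icc h').1).choose_spec.1.continuousAt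
  exact hc.tendsto.comp (tendsto_codingMap h')

/-- `y n` is the `n`-th complete quotient of the point `y 0` with continued fraction entries `ω`. -/
structure IsCoding (E : Set ℕ) (ω : ℕ → ℕ) (y : ℕ → ℝ) : Prop where
  mem : ∀ n, ω n ∈ E
  pos : ∀ n, 1 ≤ ω n
  step : ∀ n, y n = gaussMap (ω n) (y (n + 1))
  mem_Ioo : ∀ n, y n ∈ Ioo (0 : ℝ) 1

lemma exists_isCoding {E : Set ℕ} (hE : 0 ∉ E) {x : ℝ} (hx : x ∈ limitSet E) :
    ∃ ω y, IsCoding E ω y ∧ y 0 = x := by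
  obtain ⟨ω, hω, rfl⟩ := hx
  have hpos : ∀ n, 1 ≤ ω n := fun n => Nat.one_le_iff_ne_zero.2 fun h => hE (h ▸ hω n)
  set y : ℕ → ℝ := fun n => codingMap fun i => ω (i + n)
  have hstep : ∀ n, y n = gaussMap (ω n) (y (n + 1)) := by
    intro n
    have := codingMap_eq_gaussMap (ω := fun i => ω (i + n)) fun i => hpos _
    simp only [zero_add] at this
    rw [show y n = _ from this]
    congr 2
    funext i
    congr 1
    ring
  have hIcc : ∀ n, y n ∈ Icc (0 : ℝ) 1 := fun n => codingMap_mem_Icc fun i => hpos _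
  have hy0 : ∀ n, 0 < y n := by
    intro n
    have h1 := (hIcc (n + 1)).1
    have h2 : (1 : ℝ) ≤ ω n := by exact_mod_cast hpos n
    rw [hstep n, gaussMap]
    positivity
  have hy : ∀ n, y n ∈ Ioo (0 : ℝ) 1 := by
    refine fun n => ⟨hy0 n, ?_⟩
    have h1 := hy0 (n + 1)
    have h2 : (1 : ℝ) ≤ ω n := by exact_mod_cast hpos n
    rw [hstep n, gaussMap, div_lt_one (by linarith)]
    linarith
  exact ⟨ω, y, ⟨hω, hpos, hstep, hy⟩, rfl⟩

namespace IsCoding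

variable {E : Set ℕ} {ω : ℕ → ℕ} {y : ℕ → ℝ}

lemma mem_Icc (h : IsCoding E ω y) (n : ℕ) : y n ∈ Icc (0 : ℝ) 1 := Ioo_subset_Icc_self (h.mem_Ioo n)

lemma posWord (h : IsCoding E ω y) (n : ℕ) : PosWord (wordPrefix ω n) := posWord_wordPrefix h.pos n

lemma eq_wordMap (h : IsCoding E ω y) (n : ℕ) : y 0 = wordMap (wordPrefix ω n) (y n) := by
  induction n with
  | zero => rfl
  | succ n ih => rw [wordPrefix_succ, wordMap_append, wordMap_singleton, ← h.step, ← ih]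

lemma derivNorm_antitone (h : IsCoding E ω y) : Antitone fun n => derivNorm (wordPrefix ω n) := by
  refine antitone_nat_of_succ_le fun n => ?_
  rw [wordPrefix_succ]
  exact derivNorm_append_le_left (h.posWord n) (posWord_singleton (h.pos n))

lemma derivNorm_le (h : IsCoding E ω y) (n : ℕ) :
    derivNorm (wordPrefix ω n) ≤ 2 * (1 / 2 : ℝ) ^ n := by
  simpa [length_wordPrefix] using derivNorm_le_half_pow (h.posWord n)

lemma tendsto_derivNorm (h : IsCoding E ω y) :
    Tendsto (fun n => derivNorm (wordPrefix ω n)) atTop (𝓝 0) := by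
  refine squeeze_zero (fun n => (derivNorm_pos (h.posWord n)).le) h.derivNorm_le ?_
  simpa using (tendsto_pow_atTop_nhds_zero_of_lt_one (r := (1 / 2 : ℝ)) (by norm_num)
    (by norm_num)).const_mul 2

lemma mem_words (h : IsCoding E ω y) (n : ℕ) : wordPrefix ω n ∈ words E := by
  intro a ha
  obtain ⟨i, rfl⟩ := List.mem_ofFn.1 ha
  exact h.mem _

end IsCoding

/-- The density `|φ_σ'|^δ` as an extended nonnegative function. -/
def jac (δ : ℝ) (σ : List ℕ) (x : ℝ) : ℝ≥0∞ := ENNReal.ofReal (|deriv (wordMap σ) x| ^ δ)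

lemma measurable_jac (δ : ℝ) (σ : List ℕ) : Measurable (jac δ σ) := by
  unfold jac
  have := measurable_deriv (wordMap σ)
  fun_prop

lemma measurable_gaussMap (a : ℕ) : Measurable (gaussMap a) := by
  unfold gaussMap
  fun_prop

lemma jac_cons {δ : ℝ} {a : ℕ} {σ : List ℕ} (h : PosWord (a :: σ)) {x : ℝ} (hx : 0 ≤ x) :
    jac δ (a :: σ) x = jac δ [a] (wordMap σ x) * jac δ σ x := by
  have ha : PosWord [a] := posWord_singleton (h a (by simp))
  have hσ := h.of_cons.2
  have h1 := one_le_wordDen hσ hx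
  have h2 := wordMap_nonneg hσ hx
  have h3 := one_le_wordDen ha h2
  rw [jac, jac, jac, ← ENNReal.ofReal_mul (by positivity), abs_deriv_wordMap h hx,
    abs_deriv_wordMap ha h2, abs_deriv_wordMap hσ hx, ← Real.mul_rpow (by positivity) (by positivity),
    show a :: σ = [a] ++ σ from rfl, wordDen_append hσ hx, one_div_mul_one_div, ← mul_pow, mul_comm]

lemma jac_le {δ : ℝ} (hδ : 0 ≤ δ) {σ : List ℕ} (h : PosWord σ) {x : ℝ} (hx : x ∈ Icc (0 : ℝ) 1) :
    jac δ σ x ≤ ENNReal.ofReal (derivNorm σ ^ δ) := by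
  have h0 := one_le_wordDen h le_rfl
  have h1 := (wordDen_distortion h hx).1
  rw [jac, abs_deriv_wordMap h hx.1, derivNorm_eq h]
  gcongr

lemma le_jac {δ : ℝ} (hδ : 0 ≤ δ) {σ : List ℕ} (h : PosWord σ) {x : ℝ} (hx : x ∈ Icc (0 : ℝ) 1) :
    ENNReal.ofReal ((derivNorm σ / 4) ^ δ) ≤ jac δ σ x := by
  have h0 := one_le_wordDen h le_rfl
  have h1 := wordDen_distortion h hx
  have h2 : 0 < wordDen σ x := by linarith
  have : derivNorm σ / 4 = 1 / (2 * wordDen σ 0) ^ 2 := by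
    rw [derivNorm_eq h]
    field_simp
    norm_num
  rw [jac, abs_deriv_wordMap h hx.1, this]
  gcongr
  exact h1.2

lemma measurableSet_image_wordMap {σ : List ℕ} (h : PosWord σ) {A : Set ℝ} (hA : MeasurableSet A)
    (hA' : A ⊆ Icc 0 1) : MeasurableSet (wordMap σ '' A) :=
  hA.image_of_continuousOn_injOn ((continuousOn_wordMap h).mono hA') ((injOn_wordMap h).mono hA')

lemma image_wordMap_subset {σ : List ℕ} (h : PosWord σ) {A : Set ℝ} (hA' : A ⊆ Icc 0 1) :
    wordMap σ '' A ⊆ Icc 0 1 := by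
  rintro _ ⟨x, hx, rfl⟩
  exact wordMap_mem_Icc h (hA' hx)

lemma image_wordMap_append (σ τ : List ℕ) (A : Set ℝ) :
    wordMap (σ ++ τ) '' A = wordMap σ '' (wordMap τ '' A) := by
  rw [image_image]
  simp_rw [wordMap_append]

lemma cyl_append (σ τ : List ℕ) : cyl (σ ++ τ) = wordMap σ '' cyl τ :=
  image_wordMap_append σ τ _

lemma measurableSet_cyl {σ : List ℕ} (h : PosWord σ) : MeasurableSet (cyl σ) :=
  measurableSet_image_wordMap h measurableSet_Icc subset_rfl

lemma cyl_subset_Icc {σ : List ℕ} (h : PosWord σ) : cyl σ ⊆ Icc 0 1 :=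
  image_wordMap_subset h subset_rfl

lemma posWord_of_mem_words {E : Set ℕ} (hE : 0 ∉ E) {σ : List ℕ} (h : σ ∈ words E) : PosWord σ :=
  fun a ha => Nat.one_le_iff_ne_zero.2 fun h0 => hE (h0 ▸ h a ha)

namespace IsConformal

variable {E : Set ℕ} {δ : ℝ} {μ : Measure ℝ}

lemma ae_exists_isCoding (hμ : IsConformal E δ μ) (hE : 0 ∉ E) :
    ∀ᵐ x ∂μ, ∃ ω y, IsCoding E ω y ∧ y 0 = x := by
  have : ∀ᵐ x ∂μ, x ∈ limitSet E := by
    rw [ae_iff]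
    exact hμ.2.1
  exact this.mono fun x hx => exists_isCoding hE hx

lemma ae_mem_Ioo (hμ : IsConformal E δ μ) (hE : 0 ∉ E) : ∀ᵐ x ∂μ, x ∈ Ioo (0 : ℝ) 1 := by
  filter_upwards [hμ.ae_exists_isCoding hE]
  rintro _ ⟨ω, y, h, rfl⟩
  exact h.mem_Ioo 0

lemma measure_Icc (hμ : IsConformal E δ μ) (hE : 0 ∉ E) : μ (Icc 0 1) = 1 := by
  have := hμ.1
  rw [prob_compl_eq_zero_iff measurableSet_Icc |>.1]
  exact measure_mono_null (compl_subset_compl.2 Ioo_subset_Icc_self) (hμ.ae_mem_Ioo hE)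

lemma measure_inter_Icc (hμ : IsConformal E δ μ) (hE : 0 ∉ E) (A : Set ℝ) :
    μ (A ∩ Icc 0 1) = μ A := by
  refine measure_congr ?_
  filter_upwards [hμ.ae_mem_Ioo hE] with x hx
  exact propext (and_iff_left (Ioo_subset_Icc_self hx))

lemma eq_sum_map (hμ : IsConformal E δ μ) (hE : 0 ∉ E) (hδ : 0 ≤ δ) :
    μ = Measure.sum fun a : E => (μ.withDensity (jac δ [(a : ℕ)])).map (gaussMap a) := by
  have := hμ.1
  have hpos : ∀ a : E, 1 ≤ (a : ℕ) := fun a => Nat.one_le_iff_ne_zero.2 fun h => hE (h ▸ a.2)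
  ext A hA
  rw [Measure.sum_apply _ hA, ← hμ.measure_inter_Icc hE, hμ.2.2 _ inter_subset_right
    (hA.inter measurableSet_Icc)]
  refine tsum_congr fun a => ?_
  have hm : Measurable fun x => |deriv (gaussMap a) x| ^ δ := by
    have := measurable_deriv (gaussMap a)
    fun_prop
  rw [Measure.map_apply (measurable_gaussMap a) hA,
    withDensity_apply _ (measurable_gaussMap a hA), ofReal_integral_eq_lintegral_ofReal]
  · change ∫⁻ x in _, jac δ [(a : ℕ)] x ∂μ = _
    refine setLIntegral_congr ?_
    filter_upwards [hμ.ae_mem_Ioo hE] with x hx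
    refine propext (and_iff_left ?_)
    exact gaussMap_mem_Icc (hpos a) (Ioo_subset_Icc_self hx)
  · refine Integrable.integrableOn (Integrable.of_bound hm.aestronglyMeasurable 1 ?_)
    filter_upwards [hμ.ae_mem_Ioo hE] with x hx
    rw [Real.norm_of_nonneg (by positivity)]
    refine Real.rpow_le_one (abs_nonneg _) ?_ hδ
    have h1 := abs_deriv_wordMap (posWord_singleton (hpos a)) hx.1.le
    have h2 := one_le_wordDen (posWord_singleton (hpos a)) hx.1.le
    change |deriv (wordMap [(a : ℕ)]) x| ≤ 1
    rw [h1, div_le_one (by positivity)]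
    nlinarith
  · exact Eventually.of_forall fun x => by positivity

lemma lintegral_eq_tsum (hμ : IsConformal E δ μ) (hE : 0 ∉ E) (hδ : 0 ≤ δ) {F : ℝ → ℝ≥0∞}
    (hF : Measurable F) :
    ∫⁻ x, F x ∂μ = ∑' a : E, ∫⁻ x, F (gaussMap a x) * jac δ [(a : ℕ)] x ∂μ := by
  conv_lhs => rw [hμ.eq_sum_map hE hδ]
  rw [lintegral_sum_measure]
  refine tsum_congr fun a => ?_
  rw [lintegral_map hF (measurable_gaussMap a)]
  have h := lintegral_withDensity_eq_lintegral_mul μ (measurable_jac δ [(a : ℕ)])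
    (hF.comp (measurable_gaussMap a))
  simpa [mul_comm] using h

lemma gaussMap_mem_image_iff {a b : ℕ} (ha : 1 ≤ a) (hb : 1 ≤ b) {A : Set ℝ} (hA : A ⊆ Icc 0 1)
    {x : ℝ} (hx : x ∈ Ioo (0 : ℝ) 1) : gaussMap b x ∈ wordMap [a] '' A ↔ b = a ∧ x ∈ A := by
  constructor
  · rintro ⟨z, hz, hzx⟩
    have ha' : (1 : ℝ) ≤ a := by exact_mod_cast ha
    have hb' : (1 : ℝ) ≤ b := by exact_mod_cast hb
    have hz' := hA hz
    have h1 : (a : ℝ) + z = b + x := by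
      rw [wordMap_singleton, gaussMap, gaussMap] at hzx
      have h2 : (0 : ℝ) < a + z := by linarith [hz'.1]
      have h3 : (0 : ℝ) < b + x := by linarith [hx.1]
      field_simp at hzx
      linarith
    have h2 : (b : ℝ) < a + 1 := by linarith [hz'.2, hx.1]
    have h3 : (a : ℝ) < b + 1 := by linarith [hz'.1, hx.2]
    have h4 : b < a + 1 := by exact_mod_cast h2
    have h5 : a < b + 1 := by exact_mod_cast h3
    obtain rfl : b = a := by omega
    refine ⟨rfl, ?_⟩
    rwa [← add_left_cancel h1]
  · rintro ⟨rfl, hxA⟩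
    exact ⟨x, hxA, rfl⟩

lemma setLIntegral_image_singleton (hμ : IsConformal E δ μ) (hE : 0 ∉ E) (hδ : 0 ≤ δ) {a : ℕ}
    (ha : 1 ≤ a) {A : Set ℝ} (hA : MeasurableSet A) (hA' : A ⊆ Icc 0 1) {G : ℝ → ℝ≥0∞}
    (hG : Measurable G) :
    ∫⁻ x in wordMap [a] '' A, G x ∂μ =
      ∑' b : E, if (b : ℕ) = a then ∫⁻ x in A, G (gaussMap a x) * jac δ [a] x ∂μ else 0 := by
  have hS := measurableSet_image_wordMap (posWord_singleton ha) hA hA'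
  rw [← lintegral_indicator hS, hμ.lintegral_eq_tsum hE hδ (hG.indicator hS)]
  refine tsum_congr fun b => ?_
  have hb : 1 ≤ (b : ℕ) := Nat.one_le_iff_ne_zero.2 fun h => hE (h ▸ b.2)
  split_ifs with hba
  · rw [← lintegral_indicator hA]
    refine lintegral_congr_ae ?_
    filter_upwards [hμ.ae_mem_Ioo hE] with x hx
    by_cases hxA : x ∈ A
    · rw [indicator_of_mem ((gaussMap_mem_image_iff ha hb hA' hx).2 ⟨hba, hxA⟩),
        indicator_of_mem hxA, hba]
    · rw [indicator_of_notMem fun h => hxA ((gaussMap_mem_image_iff ha hb hA' hx).1 h).2,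
        indicator_of_notMem hxA, zero_mul]
  · rw [lintegral_eq_zero_iff' (by
      have := (hG.indicator hS).comp (measurable_gaussMap b)
      exact (this.mul (measurable_jac δ _)).aemeasurable)]
    filter_upwards [hμ.ae_mem_Ioo hE] with x hx
    rw [indicator_of_notMem fun h => hba ((gaussMap_mem_image_iff ha hb hA' hx).1 h).1, zero_mul]
    rfl

lemma setLIntegral_image_cons_le (hμ : IsConformal E δ μ) (hE : 0 ∉ E) (hδ : 0 ≤ δ) {σ : List ℕ}
    (hσ : PosWord σ) {A : Set ℝ} (hA : MeasurableSet A) (hA' : A ⊆ Icc 0 1) {G : ℝ → ℝ≥0∞}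
    (hG : Measurable G) :
    ∫⁻ x in wordMap σ '' A, G x ∂μ ≤ ∫⁻ x in A, G (wordMap σ x) * jac δ σ x ∂μ ∧
      (σ ∈ words E →
        ∫⁻ x in wordMap σ '' A, G x ∂μ = ∫⁻ x in A, G (wordMap σ x) * jac δ σ x ∂μ) := by
  induction σ generalizing G with
  | nil =>
    have : ∀ x, jac δ [] x = 1 := by
      intro x
      have : wordMap [] = id := rfl
      simp [jac, this]
    simp [wordMap, this]
  | cons a σ ih =>
    have hσ' := hσ.of_cons.2
    have ha : 1 ≤ a := hσ a (by simp)
    have hm := measurable_gaussMap a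
    have hG' : Measurable fun x => G (gaussMap a x) * jac δ [a] x :=
      (hG.comp hm).mul (measurable_jac δ _)
    have key : ∫⁻ x in A, G (wordMap (a :: σ) x) * jac δ (a :: σ) x ∂μ =
        ∫⁻ x in A, (G (gaussMap a (wordMap σ x)) * jac δ [a] (wordMap σ x)) * jac δ σ x ∂μ := by
      refine setLIntegral_congr_fun hA fun x hx => ?_
      rw [jac_cons hσ (hA' hx).1, mul_assoc]
      rfl
    rw [key, show a :: σ = [a] ++ σ from rfl, image_wordMap_append,
      hμ.setLIntegral_image_singleton hE hδ ha (measurableSet_image_wordMap hσ' hA hA')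
        (image_wordMap_subset hσ' hA') hG]
    refine ⟨le_trans ?_ (ih hσ' hG').1, fun hw => ?_⟩
    · by_cases haE : a ∈ E
      · rw [tsum_eq_single ⟨a, haE⟩ fun b hb => if_neg fun h => hb (Subtype.ext h)]
        simp
      · rw [ENNReal.tsum_eq_zero.2 fun b : E => if_neg fun h : (b : ℕ) = a => haE (h ▸ b.2)]
        exact zero_le
    · have haE : a ∈ E := hw a (by simp)
      rw [tsum_eq_single ⟨a, haE⟩ fun b hb => if_neg fun h => hb (Subtype.ext h), if_pos rfl]
      exact (ih hσ' hG').2 fun b hb => hw b (by simp [hb])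

lemma measure_image_eq (hμ : IsConformal E δ μ) (hE : 0 ∉ E) (hδ : 0 ≤ δ) {σ : List ℕ}
    (hσ : σ ∈ words E) {A : Set ℝ} (hA : MeasurableSet A) (hA' : A ⊆ Icc 0 1) :
    μ (wordMap σ '' A) = ∫⁻ x in A, jac δ σ x ∂μ := by
  simpa using (hμ.setLIntegral_image_cons_le hE hδ (posWord_of_mem_words hE hσ) hA hA'
    (measurable_const (a := (1 : ℝ≥0∞)))).2 hσ

lemma measure_image_le (hμ : IsConformal E δ μ) (hE : 0 ∉ E) (hδ : 0 ≤ δ) {σ : List ℕ}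
    (hσ : PosWord σ) {A : Set ℝ} (hA : MeasurableSet A) (hA' : A ⊆ Icc 0 1) :
    μ (wordMap σ '' A) ≤ ENNReal.ofReal (derivNorm σ ^ δ) * μ A := by
  have h := (hμ.setLIntegral_image_cons_le hE hδ hσ hA hA' (measurable_const (a := (1 : ℝ≥0∞)))).1
  simp only [one_mul, setLIntegral_one] at h
  refine h.trans ((setLIntegral_mono' hA fun x hx => jac_le hδ hσ (hA' hx)).trans_eq ?_)
  rw [setLIntegral_const]

lemma le_measure_image (hμ : IsConformal E δ μ) (hE : 0 ∉ E) (hδ : 0 ≤ δ) {σ : List ℕ}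
    (hσ : σ ∈ words E) {A : Set ℝ} (hA : MeasurableSet A) (hA' : A ⊆ Icc 0 1) :
    ENNReal.ofReal ((derivNorm σ / 4) ^ δ) * μ A ≤ μ (wordMap σ '' A) := by
  rw [hμ.measure_image_eq hE hδ hσ hA hA', ← setLIntegral_const]
  exact setLIntegral_mono' hA fun x hx => le_jac hδ (posWord_of_mem_words hE hσ) (hA' hx)

lemma measure_cyl_le (hμ : IsConformal E δ μ) (hE : 0 ∉ E) (hδ : 0 ≤ δ) {σ : List ℕ}
    (hσ : PosWord σ) : μ (cyl σ) ≤ ENNReal.ofReal (derivNorm σ ^ δ) := by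
  simpa [cyl, hμ.measure_Icc hE] using hμ.measure_image_le hE hδ hσ measurableSet_Icc subset_rfl

lemma le_measure_cyl (hμ : IsConformal E δ μ) (hE : 0 ∉ E) (hδ : 0 ≤ δ) {σ : List ℕ}
    (hσ : σ ∈ words E) : ENNReal.ofReal ((derivNorm σ / 4) ^ δ) ≤ μ (cyl σ) := by
  simpa [cyl, hμ.measure_Icc hE] using hμ.le_measure_image hE hδ hσ measurableSet_Icc subset_rfl

lemma measure_cyl_append_le (hμ : IsConformal E δ μ) (hE : 0 ∉ E) (hδ : 0 ≤ δ) {σ : List ℕ}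
    (hσ : σ ∈ words E) {a : ℕ} (ha : 1 ≤ a) :
    μ (cyl (σ ++ [a])) ≤ ENNReal.ofReal (4 ^ δ) * μ (cyl σ) * μ (cyl [a]) := by
  have hp := posWord_of_mem_words hE hσ
  have h0 := derivNorm_pos hp
  rw [cyl_append]
  refine (hμ.measure_image_le hE hδ hp (measurableSet_cyl (posWord_singleton ha))
    (cyl_subset_Icc (posWord_singleton ha))).trans ?_
  gcongr
  have : derivNorm σ ^ δ = 4 ^ δ * (derivNorm σ / 4) ^ δ := by
    rw [← Real.mul_rpow (by norm_num) (by positivity)]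
    congr 1
    ring
  rw [this, ENNReal.ofReal_mul (by positivity)]
  gcongr
  exact hμ.le_measure_cyl hE hδ hσ

lemma le_measure_cyl_append (hμ : IsConformal E δ μ) (hE : 0 ∉ E) (hδ : 0 ≤ δ) {σ : List ℕ}
    (hσ : σ ∈ words E) {a : ℕ} (ha : 1 ≤ a) :
    ENNReal.ofReal ((1 / 4) ^ δ) * μ (cyl σ) * μ (cyl [a]) ≤ μ (cyl (σ ++ [a])) := by
  have hp := posWord_of_mem_words hE hσ
  have h0 := derivNorm_pos hp
  rw [cyl_append]
  refine le_trans ?_ (hμ.le_measure_image hE hδ hσ (measurableSet_cyl (posWord_singleton ha))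
    (cyl_subset_Icc (posWord_singleton ha)))
  gcongr
  rw [show derivNorm σ / 4 = 1 / 4 * derivNorm σ by ring, Real.mul_rpow (by norm_num) h0.le,
    ENNReal.ofReal_mul (by positivity)]
  gcongr
  exact hμ.measure_cyl_le hE hδ hp

lemma measure_cyl_eq_image_Ioo (hμ : IsConformal E δ μ) (hE : 0 ∉ E) (hδ : 0 ≤ δ) {σ : List ℕ}
    (hσ : σ ∈ words E) : μ (cyl σ) = μ (wordMap σ '' Ioo 0 1) := by
  rw [hμ.measure_image_eq hE hδ hσ measurableSet_Ioo Ioo_subset_Icc_self, cyl,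
    hμ.measure_image_eq hE hδ hσ measurableSet_Icc subset_rfl]
  refine setLIntegral_congr ?_
  filter_upwards [hμ.ae_mem_Ioo hE] with x hx
  exact propext (iff_of_true (Ioo_subset_Icc_self hx) hx)

lemma tsum_measure_cyl_append_le (hμ : IsConformal E δ μ) (hE : 0 ∉ E) (hδ : 0 ≤ δ)
    {σ : List ℕ} (hσ : σ ∈ words E) : ∑' a : E, μ (cyl (σ ++ [(a : ℕ)])) ≤ μ (cyl σ) := by
  have hp := posWord_of_mem_words hE hσ
  have hpos : ∀ a : E, 1 ≤ (a : ℕ) := fun a => Nat.one_le_iff_ne_zero.2 fun h => hE (h ▸ a.2)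
  have hw : ∀ a : E, σ ++ [(a : ℕ)] ∈ words E := by
    intro a b hb
    rcases List.mem_append.1 hb with hb | hb
    · exact hσ b hb
    · rw [List.mem_singleton.1 hb]
      exact a.2
  simp_rw [fun a : E => hμ.measure_cyl_eq_image_Ioo hE hδ (hw a)]
  rw [← measure_iUnion]
  · refine measure_mono (iUnion_subset fun a => ?_)
    rw [image_wordMap_append]
    exact image_mono (image_wordMap_subset (posWord_singleton (hpos a)) Ioo_subset_Icc_self)
  · intro a b hab
    refine disjoint_left.2 ?_
    rintro _ ⟨x, hx, rfl⟩ ⟨z, hz, hzx⟩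
    rw [wordMap_append, wordMap_append] at hzx
    have h1 := injOn_wordMap hp (wordMap_mem_Icc (posWord_singleton (hpos b))
      (Ioo_subset_Icc_self hz)) (wordMap_mem_Icc (posWord_singleton (hpos a))
      (Ioo_subset_Icc_self hx)) hzx
    have h2 := (gaussMap_mem_image_iff (hpos a) (hpos b) (Ioo_subset_Icc_self (a := (0 : ℝ))) hz).1
      ⟨x, hx, h1.symm⟩
    exact hab (Subtype.ext h2.1.symm)
  · exact fun a => measurableSet_image_wordMap (hp.append (posWord_singleton (hpos a)))
      measurableSet_Ioo Ioo_subset_Icc_self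

end IsConformal

/-- Words of length `n` whose `i`-th letter lies in `K i`. -/
def wset (K : ℕ → Set ℕ) : ℕ → Set (List ℕ)
  | 0 => {[]}
  | n + 1 => image2 (fun σ a => σ ++ [a]) (wset K n) (K n)

lemma tsum_image2_append_le (S : Set (List ℕ)) (J : Set ℕ) (F : List ℕ → ℝ≥0∞) :
    ∑' σ : image2 (fun σ a => σ ++ [a]) S J, F σ ≤ ∑' σ : S, ∑' a : J, F (σ ++ [(a : ℕ)]) := by
  have hf : Function.Surjective fun p : S × J =>
      (⟨(p.1 : List ℕ) ++ [(p.2 : ℕ)], mem_image2_of_mem p.1.2 p.2.2⟩ :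
        image2 (fun (σ : List ℕ) (a : ℕ) => σ ++ [a]) S J) := by
    rintro ⟨_, σ, hσ, a, ha, rfl⟩
    exact ⟨⟨⟨σ, hσ⟩, ⟨a, ha⟩⟩, rfl⟩
  exact (ENNReal.tsum_le_tsum_comp_of_surjective hf fun σ => F σ).trans_eq 
    (ENNReal.tsum_prod (f := fun (σ : S) (a : J) => F ((σ : List ℕ) ++ [(a : ℕ)])))

lemma wordPrefix_mem_wset {K : ℕ → Set ℕ} {ω : ℕ → ℕ} (h : ∀ n, ω n ∈ K n) (n : ℕ) :
    wordPrefix ω n ∈ wset K n := by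
  induction n with
  | zero => rfl
  | succ n ih =>
    rw [wordPrefix_succ]
    exact mem_image2_of_mem ih (h n)

lemma append_singleton_mem_words {E : Set ℕ} {σ : List ℕ} (hσ : σ ∈ words E) {a : ℕ} (ha : a ∈ E) :
    σ ++ [a] ∈ words E := by
  intro b hb
  rcases List.mem_append.1 hb with hb | hb
  · exact hσ b hb
  · rwa [List.mem_singleton.1 hb]

lemma wset_subset_words {E : Set ℕ} {K : ℕ → Set ℕ} (h : ∀ n, K n ⊆ E) (n : ℕ) :
    wset K n ⊆ words E := by
  induction n with
  | zero =>
    rintro _ rfl a ha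
    simp at ha
  | succ n ih =>
    rintro _ ⟨σ, hσ, a, ha, rfl⟩
    exact append_singleton_mem_words (ih hσ) (h n ha)

lemma measure_le_tsum_cyl (μ : Measure ℝ) {Z : Set ℝ} {S : Set (List ℕ)}
    (h : ∀ x ∈ Z, ∃ σ ∈ S, x ∈ cyl σ) : μ Z ≤ ∑' σ : S, μ (cyl σ) := by
  refine (measure_mono fun x hx => ?_).trans (measure_biUnion_le μ S.to_countable cyl)
  simpa using h x hx

lemma IsCoding.mem_cyl {E : Set ℕ} {ω : ℕ → ℕ} {y : ℕ → ℝ} (h : IsCoding E ω y) (n : ℕ) :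
    y 0 ∈ cyl (wordPrefix ω n) :=
  ⟨y n, h.mem_Icc n, (h.eq_wordMap n).symm⟩

lemma ae_eventually_wordPrefix_notMem {E : Set ℕ} {μ : Measure ℝ} {S : ℕ → Set (List ℕ)}
    (h : ∑' n, ∑' σ : S n, μ (cyl σ) ≠ ⊤) :
    ∀ᵐ x ∂μ, ∀ ω y, IsCoding E ω y → y 0 = x → ∀ᶠ n in atTop, wordPrefix ω n ∉ S n := by
  have h1 : ∑' n, μ (⋃ σ ∈ S n, cyl σ) ≠ ⊤ := ne_top_of_le_ne_top h
    (ENNReal.tsum_le_tsum fun n => measure_biUnion_le μ (S n).to_countable cyl)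
  filter_upwards [ae_eventually_notMem h1] with x hx
  rintro ω y hω rfl
  filter_upwards [hx] with n hn hmem
  exact hn (mem_biUnion hmem (hω.mem_cyl n))

lemma ne_zero_of_mem {E : Set ℕ} (hE : 0 ∉ E) {a : ℕ} (ha : a ∈ E) : 1 ≤ a :=
  Nat.one_le_iff_ne_zero.2 fun h => hE (h ▸ ha)

namespace IsConformal

variable {E : Set ℕ} {δ : ℝ} {μ : Measure ℝ}

lemma cylMass_le_one (hμ : IsConformal E δ μ) (hE : 0 ∉ E) (hδ : 0 ≤ δ) {J : Set ℕ} (hJ : J ⊆ E) :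
    cylMass μ J ≤ 1 := by
  have := hμ.1
  have h := hμ.tsum_measure_cyl_append_le hE hδ (σ := []) (by simp [words])
  exact (ENNReal.tsum_mono_subtype (fun a => μ (cyl [a])) hJ).trans (h.trans prob_le_one)

lemma tsum_wset_le_one (hμ : IsConformal E δ μ) (hE : 0 ∉ E) (hδ : 0 ≤ δ) {K : ℕ → Set ℕ}
    (hK : ∀ n, K n ⊆ E) (n : ℕ) : ∑' σ : wset K n, μ (cyl σ) ≤ 1 := by
  have := hμ.1
  induction n with
  | zero =>
    refine (tsum_singleton [] fun σ => μ (cyl σ)).trans_le ?_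
    exact prob_le_one
  | succ n ih =>
    refine (tsum_image2_append_le _ _ fun σ => μ (cyl σ)).trans (le_trans ?_ ih)
    refine ENNReal.tsum_le_tsum fun σ => ?_
    exact (ENNReal.tsum_mono_subtype (fun a => μ (cyl ((σ : List ℕ) ++ [a]))) (hK n)).trans
      (hμ.tsum_measure_cyl_append_le hE hδ (wset_subset_words hK n σ.2))

/-- The convergence half of the Borel–Cantelli lemma for letters of random continued fractions. -/
lemma ae_eventually_letter_notMem (hμ : IsConformal E δ μ) (hE : 0 ∉ E) (hδ : 0 ≤ δ)
    {J : ℕ → Set ℕ} (hJ : ∀ n, J n ⊆ E) (h : ∑' n, cylMass μ (J n) ≠ ⊤) :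
    ∀ᵐ x ∂μ, ∀ ω y, IsCoding E ω y → y 0 = x → ∀ᶠ n in atTop, ω n ∉ J n := by
  set S : ℕ → Set (List ℕ) := fun n =>
    image2 (fun σ a => σ ++ [a]) (wset (fun _ => E) (n - 1)) (J (n - 1))
  have hS : ∀ n, ∑' σ : S n, μ (cyl σ) ≤ ENNReal.ofReal (4 ^ δ) * cylMass μ (J (n - 1)) := by
    intro n
    refine (tsum_image2_append_le _ _ fun σ => μ (cyl σ)).trans ?_
    calc _ ≤ ∑' σ : wset (fun _ => E) (n - 1), ∑' a : J (n - 1),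
          ENNReal.ofReal (4 ^ δ) * μ (cyl σ) * μ (cyl [(a : ℕ)]) := by
          refine ENNReal.tsum_le_tsum fun σ => ENNReal.tsum_le_tsum fun a => ?_
          exact hμ.measure_cyl_append_le hE hδ (wset_subset_words (fun _ => subset_rfl) _ σ.2)
            (ne_zero_of_mem hE (hJ _ a.2))
      _ = ENNReal.ofReal (4 ^ δ) * (∑' σ : wset (fun _ => E) (n - 1), μ (cyl σ)) *
          cylMass μ (J (n - 1)) := by
          simp_rw [ENNReal.tsum_mul_left, ENNReal.tsum_mul_right, ENNReal.tsum_mul_left]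
          rfl
      _ ≤ ENNReal.ofReal (4 ^ δ) * 1 * cylMass μ (J (n - 1)) := by
          gcongr
          exact hμ.tsum_wset_le_one hE hδ (fun _ => subset_rfl) _
      _ = _ := by rw [mul_one]
  have hsum : ∑' n, ∑' σ : S n, μ (cyl σ) ≠ ⊤ := by
    refine ne_top_of_le_ne_top ?_ (ENNReal.tsum_le_tsum hS)
    rw [ENNReal.tsum_mul_left]
    refine ENNReal.mul_ne_top ENNReal.ofReal_ne_top ?_
    rw [tsum_eq_zero_add' ENNReal.summable]
    refine ENNReal.add_ne_top.2 ⟨ne_top_of_le_ne_top h (ENNReal.le_tsum 0), h⟩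
  filter_upwards [ae_eventually_wordPrefix_notMem (E := E) hsum] with x hx ω y hω hy
  filter_upwards [(tendsto_add_atTop_nat 1).eventually (hx ω y hω hy)] with n hn hmem
  refine hn ?_
  rw [wordPrefix_succ]
  exact mem_image2_of_mem (wordPrefix_mem_wset hω.mem n) hmem

lemma tsum_wset_succ_add_le (hμ : IsConformal E δ μ) (hE : 0 ∉ E) (hδ : 0 ≤ δ)
    {K : ℕ → Set ℕ} (hK : ∀ n, K n ⊆ E) {J : Set ℕ} (hJ : J ⊆ E) {n : ℕ}
    (hKJ : Disjoint (K n) J) :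
    ∑' σ : wset K (n + 1), μ (cyl σ) +
      ENNReal.ofReal ((1 / 4) ^ δ) * cylMass μ J * ∑' σ : wset K n, μ (cyl σ) ≤
        ∑' σ : wset K n, μ (cyl σ) := by
  have hw := wset_subset_words hK n
  calc _ ≤ ∑' σ : wset K n, ∑' a : K n, μ (cyl (σ ++ [(a : ℕ)])) +
        ∑' σ : wset K n, ∑' a : J, μ (cyl (σ ++ [(a : ℕ)])) := by
        refine add_le_add (tsum_image2_append_le _ _ fun σ => μ (cyl σ)) ?_
        rw [← ENNReal.tsum_mul_left]
        refine ENNReal.tsum_le_tsum fun σ => ?_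
        rw [mul_right_comm, cylMass, ← ENNReal.tsum_mul_left]
        exact ENNReal.tsum_le_tsum fun a =>
          hμ.le_measure_cyl_append hE hδ (hw σ.2) (ne_zero_of_mem hE (hJ a.2))
    _ ≤ _ := by
        rw [← ENNReal.tsum_add]
        refine ENNReal.tsum_le_tsum fun σ => ?_
        rw [← Summable.tsum_union_disjoint (f := fun a => μ (cyl ((σ : List ℕ) ++ [a]))) hKJ
          ENNReal.summable ENNReal.summable]
        exact (ENNReal.tsum_mono_subtype (fun a => μ (cyl ((σ : List ℕ) ++ [a])))
          (union_subset (hK n) hJ)).trans (hμ.tsum_measure_cyl_append_le hE hδ (hw σ.2))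

/-- The divergence half of the Borel–Cantelli lemma for letters of random continued fractions. -/
lemma ae_frequently_letter_mem (hμ : IsConformal E δ μ) (hE : 0 ∉ E) (hδ : 0 ≤ δ)
    {J : ℕ → Set ℕ} (hJ : ∀ n, J n ⊆ E) (h : ∑' n, cylMass μ (J n) = ⊤) :
    ∀ᵐ x ∂μ, ∀ ω y, IsCoding E ω y → y 0 = x → ∃ᶠ n in atTop, ω n ∈ J n := by
  have := hμ.1
  have key : ∀ N, ∀ᵐ x ∂μ, ¬ ∃ ω y, IsCoding E ω y ∧ y 0 = x ∧ ∀ n, N ≤ n → ω n ∉ J n := by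
    intro N
    rw [ae_iff]
    simp only [not_not]
    set Z := {x | ∃ ω y, IsCoding E ω y ∧ y 0 = x ∧ ∀ n, N ≤ n → ω n ∉ J n}
    set K : ℕ → Set ℕ := fun n => if N ≤ n then E \ J n else E
    set c := ENNReal.ofReal ((1 / 4) ^ δ)
    have hc : c ≠ 0 := by simp [c]; positivity
    have hK : ∀ n, K n ⊆ E := by
      intro n
      simp only [K]
      split_ifs
      exacts [sdiff_subset, subset_rfl]
    have hZ : ∀ n, μ Z ≤ ∑' σ : wset K n, μ (cyl σ) := by
      refine fun n => measure_le_tsum_cyl μ ?_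
      rintro _ ⟨ω, y, hω, rfl, hn⟩
      refine ⟨_, wordPrefix_mem_wset (fun i => ?_) n, hω.mem_cyl n⟩
      simp only [K]
      split_ifs with hi
      exacts [⟨hω.mem i, hn i hi⟩, hω.mem i]
    have hsum : ∀ k, ∑' σ : wset K (N + k), μ (cyl σ) +
        c * (∑ i ∈ Finset.range k, cylMass μ (J (i + N))) * μ Z ≤ 1 := by
      intro k
      induction k with
      | zero => simpa using hμ.tsum_wset_le_one hE hδ hK N
      | succ k ih =>
        refine le_trans ?_ ih
        rw [Finset.sum_range_succ, mul_add, add_mul, add_comm (c * _ * _), ← add_assoc]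
        gcongr
        refine le_trans ?_ (hμ.tsum_wset_succ_add_le hE hδ hK (hJ (N + k)) ?_)
        · rw [add_comm k N]
          exact add_le_add le_rfl (mul_le_mul_right (hZ _) _)
        · simp only [K, if_pos (Nat.le_add_right N k)]
          exact disjoint_sdiff_left
    have hsum' : c * (∑' i, cylMass μ (J (i + N))) * μ Z ≤ 1 := by
      rw [ENNReal.tsum_eq_iSup_nat, ENNReal.mul_iSup, ENNReal.iSup_mul]
      exact iSup_le fun k => le_add_self.trans (hsum k)
    have htop : ∑' i, cylMass μ (J (i + N)) = ⊤ := by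
      have h' := Summable.sum_add_tsum_nat_add' (f := fun i => cylMass μ (J i)) (k := N)
        ENNReal.summable
      rw [h] at h'
      rcases ENNReal.add_eq_top.1 h' with h' | h'
      · obtain ⟨i, -, hi⟩ := ENNReal.sum_eq_top.1 h'
        exact absurd hi (ne_top_of_le_ne_top ENNReal.one_ne_top
          (hμ.cylMass_le_one hE hδ (hJ i)))
      · exact h'
    rw [htop, ENNReal.mul_top hc] at hsum'
    by_contra hne
    rw [ENNReal.top_mul hne] at hsum'
    exact absurd hsum' (by simp)
  filter_upwards [ae_all_iff.2 key] with x hx ω y hω hy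
  refine frequently_atTop.2 fun N => ?_
  by_contra! hcon
  exact hx N ⟨ω, y, hω, hy, hcon⟩

lemma ae_eventually_le_derivNorm (hμ : IsConformal E δ μ) (hE : 0 ∉ E) (hδ : 0 ≤ δ) {θ : ℝ}
    (hθ : 0 ≤ θ) (hθδ : θ < δ) (h : ∑' a : E, ENNReal.ofReal (derivNorm [(a : ℕ)] ^ θ) ≠ ⊤)
    {lam : ℝ} (hlam : 1 < lam) :
    ∃ L : ℕ, 1 ≤ L ∧ ∀ᵐ x ∂μ, ∀ ω y, IsCoding E ω y → y 0 = x →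
      ∀ᶠ n in atTop, lam⁻¹ ^ (L * n) ≤ derivNorm (wordPrefix ω n) := by
  set B := ∑' a : E, ENNReal.ofReal (derivNorm [(a : ℕ)] ^ θ)
  set W := fun n => wset (fun _ => E) n
  have hW : ∀ n, W n ⊆ words E := fun n => wset_subset_words (fun _ => subset_rfl) n
  have hB : ∀ n, ∑' σ : W n, ENNReal.ofReal (derivNorm σ ^ θ) ≤ B ^ n := by
    intro n
    induction n with
    | zero =>
      refine (tsum_singleton [] fun σ => ENNReal.ofReal (derivNorm σ ^ θ)).trans_le ?_
      simp only [pow_zero, ENNReal.ofReal_le_one]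
      have h0 : PosWord [] := by simp [PosWord]
      exact Real.rpow_le_one (derivNorm_pos h0).le (derivNorm_le_one h0) hθ
    | succ n ih =>
      refine (tsum_image2_append_le _ _ fun σ => ENNReal.ofReal (derivNorm σ ^ θ)).trans ?_
      calc _ ≤ ∑' σ : W n, ∑' a : E,
            ENNReal.ofReal (derivNorm σ ^ θ) * ENNReal.ofReal (derivNorm [(a : ℕ)] ^ θ) := by
            refine ENNReal.tsum_le_tsum fun σ => ENNReal.tsum_le_tsum fun a => ?_
            have h1 := posWord_of_mem_words hE (hW n σ.2)
            have h2 := posWord_singleton (ne_zero_of_mem hE a.2)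
            have h3 := derivNorm_pos h1
            have h4 := derivNorm_pos h2
            rw [← ENNReal.ofReal_mul (by positivity), ← Real.mul_rpow h3.le h4.le]
            have h5 := derivNorm_pos (h1.append h2)
            gcongr
            exact derivNorm_append_le h1 h2
        _ = (∑' σ : W n, ENNReal.ofReal (derivNorm σ ^ θ)) * B := by
            simp_rw [ENNReal.tsum_mul_left, ENNReal.tsum_mul_right]
            rfl
        _ ≤ _ := by
            rw [pow_succ]
            gcongr
  set q := ENNReal.ofReal (lam⁻¹ ^ (δ - θ))
  have hq : q < 1 := by
    rw [ENNReal.ofReal_lt_one]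
    exact Real.rpow_lt_one (by positivity) (inv_lt_one_of_one_lt₀ hlam) (by linarith)
  obtain ⟨L, hL1, hL⟩ : ∃ L : ℕ, 1 ≤ L ∧ q ^ L * B < 1 / 2 := by
    have h1 : Tendsto (fun L : ℕ => q ^ L * B) atTop (𝓝 0) := by
      simpa using ENNReal.Tendsto.mul_const (ENNReal.tendsto_pow_atTop_nhds_zero_of_lt_one hq)
        (Or.inr h)
    exact ((eventually_ge_atTop 1).and (h1.eventually_lt_const (by norm_num))).exists
  refine ⟨L, hL1, ?_⟩
  set S : ℕ → Set (List ℕ) := fun n => {σ ∈ W n | derivNorm σ < lam⁻¹ ^ (L * n)}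
  have hS : ∀ n, ∑' σ : S n, μ (cyl σ) ≤ (1 / 2) ^ n := by
    intro n
    calc _ ≤ ∑' σ : S n, q ^ (L * n) * ENNReal.ofReal (derivNorm σ ^ θ) := by
          refine ENNReal.tsum_le_tsum fun σ => ?_
          have h1 := posWord_of_mem_words hE (hW n σ.2.1)
          have h2 := derivNorm_pos h1
          refine (hμ.measure_cyl_le hE hδ h1).trans ?_
          rw [← ENNReal.ofReal_pow (by positivity), ← ENNReal.ofReal_mul (by positivity),
            ← Real.rpow_mul_natCast (by positivity), mul_comm (δ - θ),
            Real.rpow_natCast_mul (by positivity)]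
          refine ENNReal.ofReal_le_ofReal ?_
          have h3 : derivNorm σ ^ δ = derivNorm σ ^ (δ - θ) * derivNorm σ ^ θ := by
            rw [← Real.rpow_add h2]
            simp
          rw [h3]
          exact mul_le_mul_of_nonneg_right (Real.rpow_le_rpow h2.le σ.2.2.le (by linarith))
            (by positivity)
      _ = q ^ (L * n) * ∑' σ : S n, ENNReal.ofReal (derivNorm σ ^ θ) := ENNReal.tsum_mul_left
      _ ≤ q ^ (L * n) * B ^ n := by
          gcongr
          exact (ENNReal.tsum_mono_subtype (fun σ => ENNReal.ofReal (derivNorm σ ^ θ))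
            fun σ hσ => hσ.1).trans (hB n)
      _ ≤ _ := by
          rw [pow_mul, ← mul_pow]
          gcongr
  have hsum : ∑' n, ∑' σ : S n, μ (cyl σ) ≠ ⊤ := by
    refine ne_top_of_le_ne_top ?_ (ENNReal.tsum_le_tsum hS)
    simp [ENNReal.tsum_geometric, ENNReal.one_sub_inv_two]
  filter_upwards [ae_eventually_wordPrefix_notMem (E := E) hsum] with x hx ω y hω hy
  filter_upwards [hx ω y hω hy] with n hn
  by_contra! hcon
  exact hn ⟨wordPrefix_mem_wset hω.mem n, hcon⟩

end IsConformal

/-- Under Assumption 1 the series `∑_{a ∈ E} ‖φ_a'‖^θ` converges for `θ > s/2`. -/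
lemma Assumption1.tsum_derivNorm_ne_top {E : Set ℕ} (hE : 0 ∉ E) {f : ℝ → ℝ} {s θ : ℝ}
    (h1 : Assumption1 E f) (hreg : RegVarying f s) (hθ : 0 ≤ θ) (hsθ : s < 2 * θ) :
    ∑' a : E, ENNReal.ofReal (derivNorm [(a : ℕ)] ^ θ) ≠ ⊤ := by
  obtain ⟨c, C, hc, hC, hN⟩ := h1
  have hpow : ∀ j : ℕ, 1 ≤ 2 ^ j := fun j => Nat.one_le_two_pow
  set q : ℝ := (1 / 2 : ℝ) ^ (2 * θ)
  have hq : 0 < q := by positivity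
  set g : ℕ → ℝ := fun j => C * f ((2 ^ j : ℕ) : ℝ) * q ^ j
  have hf0 : ∀ j : ℕ, 0 ≤ f ((2 ^ j : ℕ) : ℝ) := by
    intro j
    have := (hN (2 ^ j) (hpow j)).2
    have h2 : (0 : ℝ) ≤ C * f ((2 ^ j : ℕ) : ℝ) := le_trans (by positivity) this
    exact nonneg_of_mul_nonneg_right h2 hC
  have hlim : Tendsto (fun j : ℕ => f ((2 ^ (j + 1) : ℕ) : ℝ) / f ((2 ^ j : ℕ) : ℝ)) atTop
      (𝓝 (2 ^ s)) := by
    have h2 : Tendsto (fun j : ℕ => ((2 ^ j : ℕ) : ℝ)) atTop atTop :=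
      tendsto_natCast_atTop_atTop.comp (tendsto_pow_atTop_atTop_of_one_lt one_lt_two)
    refine ((hreg 2 one_lt_two).comp h2).congr fun j => ?_
    simp only [Function.comp]
    rw [pow_succ']
    push_cast
    rfl
  have hne : ∀ᶠ j : ℕ in atTop, f ((2 ^ j : ℕ) : ℝ) ≠ 0 := by
    have h2 : (0 : ℝ) < 2 ^ s := by positivity
    filter_upwards [hlim.eventually_const_lt h2] with j hj h0
    rw [h0, div_zero] at hj
    exact lt_irrefl _ hj
  have hsum : Summable g := by
    refine summable_of_ratio_test_tendsto_lt_one (l := 2 ^ s * q) ?_ ?_ ?_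
    · have : q = (2 : ℝ) ^ (-(2 * θ)) := by
        simp only [q]
        rw [one_div, Real.inv_rpow (by norm_num), Real.rpow_neg (by norm_num)]
      rw [this, ← Real.rpow_add (by norm_num)]
      exact Real.rpow_lt_one_of_one_lt_of_neg one_lt_two (by linarith)
    · filter_upwards [hne] with j hj
      simp only [g]
      positivity
    · refine (hlim.mul_const q).congr' ?_
      filter_upwards [hne] with j hj
      have e1 := hf0 j
      have e2 := hf0 (j + 1)
      simp only [g]
      rw [Real.norm_of_nonneg (by positivity), Real.norm_of_nonneg (by positivity), pow_succ q]
      field_simp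
  set F : ℕ → ℝ≥0∞ := fun a => ENNReal.ofReal (derivNorm [a] ^ θ)
  have hcov : E ⊆ ⋃ j : ℕ, E ∩ Icc (2 ^ j) (2 * 2 ^ j) := by
    intro a ha
    have ha0 := ne_zero_of_mem hE ha
    refine mem_iUnion.2 ⟨Nat.log 2 a, ha, Nat.pow_log_le_self 2 (by omega), ?_⟩
    rw [← pow_succ']
    exact (Nat.lt_pow_succ_log_self one_lt_two a).le
  refine ne_top_of_le_ne_top hsum.tsum_ofReal_ne_top ?_
  refine (ENNReal.tsum_mono_subtype F hcov).trans ((ENNReal.tsum_iUnion_le_tsum F _).trans ?_)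
  refine ENNReal.tsum_le_tsum fun j => ?_
  have hfin : (E ∩ Icc (2 ^ j) (2 * 2 ^ j)).Finite := (finite_Icc _ _).inter_of_right E
  calc ∑' a : (E ∩ Icc (2 ^ j) (2 * 2 ^ j) : Set ℕ), F a ≤
        ∑' a : (E ∩ Icc (2 ^ j) (2 * 2 ^ j) : Set ℕ), ENNReal.ofReal (q ^ j) := by
        refine ENNReal.tsum_le_tsum fun a => ENNReal.ofReal_le_ofReal ?_
        have ha0 := ne_zero_of_mem hE a.2.1
        have ha : ((2 : ℝ) ^ j) ≤ (a : ℕ) := by exact_mod_cast a.2.2.1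
        have ha' : (0 : ℝ) < (a : ℕ) := by exact_mod_cast ha0
        rw [derivNorm_singleton ha0]
        have : q ^ j = (1 / (2 ^ j) ^ 2) ^ θ := by
          simp only [q]
          rw [← Real.rpow_mul_natCast (by norm_num), mul_right_comm, Real.rpow_mul (by norm_num)]
          congr 1
          rw [← Nat.cast_ofNat, ← Nat.cast_mul, Real.rpow_natCast]
          rw [mul_comm 2 j, pow_mul]
          simp
        rw [this]
        gcongr
    _ = (E ∩ Icc (2 ^ j) (2 * 2 ^ j)).ncard * ENNReal.ofReal (q ^ j) := by
        have := hfin.fintype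
        rw [tsum_fintype, Finset.sum_const, nsmul_eq_mul, Finset.card_univ,
          ← Nat.card_eq_fintype_card]
        rfl
    _ ≤ ENNReal.ofReal (g j) := by
        rw [← ENNReal.ofReal_natCast, ← ENNReal.ofReal_mul (by positivity)]
        refine ENNReal.ofReal_le_ofReal ?_
        have := (hN (2 ^ j) (hpow j)).2
        exact mul_le_mul_of_nonneg_right this (by positivity)

lemma gaussMap_left_param {c z ρ : ℝ} (hc : 1 ≤ c) (hρ : 8 * c ^ 2 * ρ ≤ 1) (hz : z ≤ 1 / c)
    (hz' : 1 / c - 2 * ρ ≤ z) :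
    0 < z ∧ 0 ≤ 1 / z - c ∧ 1 / z - c ≤ 4 * ρ * c ^ 2 := by
  have hc0 : 0 < c := by linarith
  have h1 : z * c ≤ 1 := by rwa [le_div_iff₀ hc0] at hz
  have h2 : 1 - 2 * ρ * c ≤ z * c := by
    have := mul_le_mul_of_nonneg_right hz' hc0.le
    rwa [sub_mul, one_div_mul_cancel hc0.ne'] at this
  have hρ0 : 0 ≤ ρ * c := by nlinarith
  have h3 : 8 * (ρ * c) ≤ 1 := by nlinarith
  have h4 : 3 / 4 ≤ z * c := by nlinarith
  have hz0 : 0 < z := by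
    by_contra! h
    nlinarith
  refine ⟨hz0, ?_, ?_⟩
  · rw [sub_nonneg, le_div_iff₀ hz0]
    linarith
  · rw [sub_le_iff_le_add, div_le_iff₀ hz0]
    nlinarith

lemma gaussMap_right_param {c z ρ : ℝ} (hc : 1 ≤ c) (hρ : 8 * (c + 1) ^ 2 * ρ ≤ 1)
    (hz : 1 / (c + 1) ≤ z) (hz' : z ≤ 1 / (c + 1) + 2 * ρ) :
    ∃ t, 0 ≤ t ∧ t ≤ 4 * ρ * (c + 1) ^ 2 ∧ z = 1 / (c + 1 / (1 + t)) := by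
  have hc0 : 0 < c + 1 := by linarith
  have h1 : 1 ≤ z * (c + 1) := by rwa [div_le_iff₀ hc0] at hz
  have h2 : z * (c + 1) ≤ 1 + 2 * ρ * (c + 1) := by
    have := mul_le_mul_of_nonneg_right hz' hc0.le
    rwa [add_mul, one_div_mul_cancel hc0.ne'] at this
  have hρ0 : 0 ≤ ρ * (c + 1) := by nlinarith
  have h3 : 8 * (ρ * (c + 1)) ≤ 1 := by nlinarith
  have h4 : 3 / 4 ≤ (1 - z * c) * (c + 1) := by nlinarith
  have h5 : 0 < 1 - z * c := by
    by_contra! h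
    nlinarith
  refine ⟨(z * (c + 1) - 1) / (1 - z * c), div_nonneg (by linarith) h5.le, ?_, ?_⟩
  · rw [div_le_iff₀ h5]
    nlinarith
  · have h6 : 1 + (z * (c + 1) - 1) / (1 - z * c) = z / (1 - z * c) := by
      field_simp
      ring
    have hz0 : 0 < z := lt_of_lt_of_le (by positivity) hz
    rw [h6]
    field_simp
    ring

lemma derivNorm_pair_one {a : ℕ} (ha : 1 ≤ a) : derivNorm [a, 1] = 1 / ((a : ℝ) + 1) ^ 2 := by
  rw [derivNorm_eq (by intro b hb; simp at hb; omega)]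
  simp [wordDen_cons, wordNum_cons]

namespace IsConformal

variable {E : Set ℕ} {δ : ℝ} {μ : Measure ℝ}

/-- The measure of a neighbourhood of the point `1/c`, which is the common endpoint of two
cylinders, is controlled by the measure of a neighbourhood of `0`. -/
lemma measure_near_inv_le (hμ : IsConformal E δ μ) (hE : 0 ∉ E) (hδ : 0 ≤ δ) {c : ℕ} (hc : 1 ≤ c)
    {ρ : ℝ} (hρ : 8 * (c : ℝ) ^ 2 * ρ ≤ 1) {J : Set ℝ} (hJ : J ⊆ Icc 0 1)
    (hJc : ∀ z ∈ J, |z - 1 / c| ≤ 2 * ρ) :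
    μ J ≤ ENNReal.ofReal (2 * (1 / (c : ℝ) ^ 2) ^ δ) * μ (Icc 0 (4 * ρ * (c : ℝ) ^ 2)) := by
  have hc' : (1 : ℝ) ≤ c := by exact_mod_cast hc
  set T := Icc 0 (4 * ρ * (c : ℝ) ^ 2)
  have hT : T ⊆ Icc 0 1 := Icc_subset_Icc_right (by nlinarith)
  have h1 : μ (J ∩ Iic (1 / c)) ≤ ENNReal.ofReal ((1 / (c : ℝ) ^ 2) ^ δ) * μ T := by
    rw [← derivNorm_singleton hc]
    refine (measure_mono ?_).trans (hμ.measure_image_le hE hδ (posWord_singleton hc)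
      measurableSet_Icc hT)
    rintro z ⟨hz, hzc⟩
    obtain ⟨h1, h2, h3⟩ := gaussMap_left_param hc' hρ hzc (by
      linarith [(abs_le.1 (hJc z hz)).1])
    refine ⟨1 / z - c, ⟨h2, h3⟩, ?_⟩
    rw [wordMap_singleton, gaussMap]
    simp
  have h2 : μ (J ∩ Ioi (1 / c)) ≤ ENNReal.ofReal ((1 / (c : ℝ) ^ 2) ^ δ) * μ T := by
    obtain ⟨b, rfl⟩ := Nat.exists_eq_add_of_le' hc
    rcases Nat.eq_zero_or_pos b with rfl | hb
    · rw [show J ∩ Ioi (1 / ((0 + 1 : ℕ) : ℝ)) = ∅ from ?_]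
      · simp
      · ext z
        simp only [mem_inter_iff, mem_Ioi, mem_empty_iff_false, iff_false, not_and, not_lt]
        intro hz
        simpa using (hJ hz).2
    · have hb' : (1 : ℝ) ≤ b := by exact_mod_cast hb
      have hw : PosWord [b, 1] := by
        intro a ha
        simp at ha
        omega
      have := derivNorm_pair_one hb
      push_cast at *
      rw [← this]
      refine (measure_mono ?_).trans (hμ.measure_image_le hE hδ hw measurableSet_Icc hT)
      rintro z ⟨hz, hzc⟩
      obtain ⟨t, h1, h2, h3⟩ := gaussMap_right_param hb' hρ (le_of_lt hzc) (by
        linarith [(abs_le.1 (hJc z hz)).2])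
      refine ⟨t, ⟨h1, by push_cast; exact h2⟩, ?_⟩
      rw [h3]
      simp [wordMap, gaussMap]
  calc μ J ≤ μ (J ∩ Iic (1 / c)) + μ (J ∩ Ioi (1 / c)) := by
        refine (measure_mono fun z hz => ?_).trans (measure_union_le _ _)
        rcases le_or_gt z (1 / c) with h | h
        exacts [Or.inl ⟨hz, h⟩, Or.inr ⟨hz, h⟩]
    _ ≤ _ := by
        refine (add_le_add h1 h2).trans_eq ?_
        rw [← two_mul, ENNReal.ofReal_mul zero_le_two, mul_assoc]
        simp

end IsConformal

lemma IsCoding.exists_maximal_cyl {E : Set ℕ} {ω : ℕ → ℕ} {y : ℕ → ℝ} (h : IsCoding E ω y) {r : ℝ}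
    (hr : 0 < r) (hr' : r ≤ 1 / 2) :
    ∃ m, r ≤ derivNorm (wordPrefix ω m) ∧
      closedBall (y 0) r ∩ Icc 0 1 ⊆ cyl (wordPrefix ω m) ∧
      ¬ closedBall (y 0) r ∩ Icc 0 1 ⊆ cyl (wordPrefix ω (m + 1)) := by
  have hx := h.mem_Icc 0
  have hle : ∀ n, closedBall (y 0) r ∩ Icc 0 1 ⊆ cyl (wordPrefix ω n) →
      r ≤ derivNorm (wordPrefix ω n) := by
    intro n hn
    obtain ⟨p, hp, hpr⟩ : ∃ p ∈ Icc (0 : ℝ) 1, |p - y 0| = r := by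
      rcases le_total (y 0) (1 / 2) with h1 | h1
      · exact ⟨y 0 + r, ⟨by linarith [hx.1], by linarith⟩, by simp [abs_of_pos hr]⟩
      · exact ⟨y 0 - r, ⟨by linarith, by linarith [hx.2]⟩, by simp [abs_of_pos hr]⟩
    obtain ⟨z, hz, rfl⟩ := hn ⟨by rw [mem_closedBall, Real.dist_eq, hpr], hp⟩
    rw [h.eq_wordMap n] at hpr
    have h1 := abs_wordMap_sub_le (h.posWord n) hz (h.mem_Icc n)
    have h2 : |z - y n| ≤ 1 :=
      abs_le.2 ⟨by linarith [hz.1, (h.mem_Icc n).2], by linarith [hz.2, (h.mem_Icc n).1]⟩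
    rw [hpr] at h1
    exact h1.trans (mul_le_of_le_one_right (derivNorm_pos (h.posWord n)).le h2)
  have hex : ∃ n, ¬ closedBall (y 0) r ∩ Icc 0 1 ⊆ cyl (wordPrefix ω n) := by
    obtain ⟨n, hn⟩ := (h.tendsto_derivNorm.eventually_lt_const hr).exists
    exact ⟨n, fun hc => absurd (hle n hc) (not_le.2 hn)⟩
  classical
  have h0 : Nat.find hex ≠ 0 := by
    intro h0
    have := Nat.find_spec hex
    rw [h0, wordPrefix_zero] at this
    refine this fun p hp => ?_
    exact ⟨p, hp.2, rfl⟩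
  obtain ⟨m, hm⟩ := Nat.exists_eq_succ_of_ne_zero h0
  have h1 := not_not.1 (Nat.find_min hex (m := m) (by omega))
  refine ⟨m, hle m h1, h1, ?_⟩
  have := Nat.find_spec hex
  rwa [hm] at this

/-- A point in the limit set close to an endpoint of a first-level cylinder has, after one or two
further steps, a tail close to `0`. -/
lemma IsCoding.exists_tail_near_zero {E : Set ℕ} {ω : ℕ → ℕ} {y : ℕ → ℝ} (h : IsCoding E ω y)
    {m c : ℕ} (hc : c = ω m ∨ c = ω m + 1) {ρ : ℝ} (hρ : 8 * (c : ℝ) ^ 2 * ρ ≤ 1)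
    (hy : |y m - 1 / c| ≤ 2 * ρ) :
    ∃ n, m < n ∧ y n ≤ 4 * ρ * (c : ℝ) ^ 2 ∧
      derivNorm (wordPrefix ω m) * (1 / (c : ℝ) ^ 2) / 4 ≤ derivNorm (wordPrefix ω n) ∧
      derivNorm (wordPrefix ω n) ≤ derivNorm (wordPrefix ω m) * (1 / (c : ℝ) ^ 2) := by
  have ha : (1 : ℝ) ≤ ω m := by exact_mod_cast h.pos m
  have hpos := h.mem_Ioo (m + 1)
  have hstep : y m = 1 / (ω m + y (m + 1)) := h.step m
  rcases hc with rfl | rfl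
  · refine ⟨m + 1, by omega, ?_, ?_⟩
    · have h1 : y m ≤ 1 / ω m := by
        rw [hstep]
        exact one_div_le_one_div_of_le (by linarith) (by linarith [hpos.1])
      obtain ⟨h2, h3, h4⟩ := gaussMap_left_param ha hρ h1 (by linarith [(abs_le.1 hy).1])
      rw [hstep] at h4
      simpa using h4
    · have hw := posWord_singleton (h.pos m)
      rw [wordPrefix_succ, ← derivNorm_singleton (h.pos m)]
      exact ⟨le_derivNorm_append (h.posWord m) hw, derivNorm_append_le (h.posWord m) hw⟩
  · push_cast at hy hρ ⊢
    have h1 : 1 / ((ω m : ℝ) + 1) ≤ y m := by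
      rw [hstep]
      exact one_div_le_one_div_of_le (by linarith [hpos.1]) (by linarith [hpos.2])
    obtain ⟨t, h2, h3, h4⟩ := gaussMap_right_param ha hρ h1 (by linarith [(abs_le.1 hy).2])
    have hpos2 := h.mem_Ioo (m + 2)
    have hω1 : (1 : ℝ) ≤ ω (m + 1) := by exact_mod_cast h.pos (m + 1)
    have hstep2 : y (m + 1) = 1 / (ω (m + 1) + y (m + 2)) := h.step (m + 1)
    have h5 : 1 + t = ω (m + 1) + y (m + 2) := by
      rw [hstep] at h4
      have h6 : (ω m : ℝ) + y (m + 1) = ω m + 1 / (1 + t) := by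
        simpa only [one_div, inv_inj] using h4
      have h7 := add_left_cancel h6
      rw [hstep2] at h7
      simpa only [one_div, inv_inj] using h7.symm
    have h6 : ω (m + 1) = 1 := by
      have h7 : (ω (m + 1) : ℝ) < 2 := by nlinarith [hpos2.1]
      have h8 : ω (m + 1) < 2 := by exact_mod_cast h7
      have := h.pos (m + 1)
      omega
    refine ⟨m + 2, by omega, ?_, ?_⟩
    · rw [h6] at h5
      push_cast at h5
      linarith
    · have hw : PosWord [ω m, 1] := by
        intro a ha
        have := h.pos m
        simp at ha
        omega
      rw [wordPrefix_succ, wordPrefix_succ, h6, List.append_assoc, ← derivNorm_pair_one (h.pos m)]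
      exact ⟨le_derivNorm_append (h.posWord m) hw, derivNorm_append_le (h.posWord m) hw⟩

lemma IsCoding.mem_cyl_singleton {E : Set ℕ} {ω : ℕ → ℕ} {y : ℕ → ℝ} (h : IsCoding E ω y) (n : ℕ) :
    y n ∈ cyl [ω n] :=
  ⟨y (n + 1), h.mem_Icc (n + 1), (h.step n).symm⟩

/-- The measure of a small ball around a point of the limit set is controlled by the measure of
a neighbourhood of a first-level cylinder, at a comparable scale after renormalisation. -/
lemma IsConformal.exists_measure_closedBall_le {E : Set ℕ} {δ : ℝ} {μ : Measure ℝ}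
    (hμ : IsConformal E δ μ) (hE : 0 ∉ E) (hδ : 0 ≤ δ) {ω : ℕ → ℕ} {y : ℕ → ℝ}
    (h : IsCoding E ω y) {r : ℝ} (hr : 0 < r) (hr' : r ≤ 1 / 2) :
    ∃ n ρ, derivNorm [ω n] ≤ ρ ∧ ρ ≤ 1 ∧ r ≤ 128 * (ρ * derivNorm (wordPrefix ω n)) ∧
      ρ * derivNorm (wordPrefix ω n) ≤ 128 * r ∧
      μ (closedBall (y 0) r) ≤ ENNReal.ofReal (2 * (4 * derivNorm (wordPrefix ω n)) ^ δ) *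
        μ (cthickening ρ (cyl [ω n])) := by
  obtain ⟨m, hrm, hm, hm'⟩ := h.exists_maximal_cyl hr hr'
  have hτ := h.posWord m
  set τ := wordPrefix ω m with hτ_def
  set N := derivNorm τ
  have hN : 0 < N := derivNorm_pos hτ
  set ρ₀ := 4 * r / N
  have hρ₀ : 0 < ρ₀ := by positivity
  have hrρ : r = ρ₀ * N / 4 := by
    simp only [ρ₀]
    field_simp
  set J := Icc (0 : ℝ) 1 ∩ wordMap τ ⁻¹' closedBall (y 0) r
  have hJm : MeasurableSet J :=
    ((continuousOn_wordMap hτ).preimage_isClosed_of_isClosed isClosed_Icc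
      isClosed_closedBall).measurableSet
  have hJ01 : J ⊆ Icc 0 1 := inter_subset_left
  have hJy : ∀ z ∈ J, |z - y m| ≤ ρ₀ := by
    rintro z ⟨hz, hzr⟩
    have h1 := le_abs_wordMap_sub hτ hz (h.mem_Icc m)
    rw [mem_preimage, mem_closedBall, Real.dist_eq, h.eq_wordMap m] at hzr
    have h2 := h1.trans hzr
    simp only [ρ₀]
    rw [le_div_iff₀ hN]
    linarith
  have hμJ : μ (closedBall (y 0) r) ≤ ENNReal.ofReal (N ^ δ) * μ J := by
    rw [← hμ.measure_inter_Icc hE]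
    refine (measure_mono ?_).trans (hμ.measure_image_le hE hδ hτ hJm hJ01)
    intro p hp
    obtain ⟨z, hz, rfl⟩ := hm hp
    exact ⟨z, ⟨hz, hp.1⟩, rfl⟩
  obtain ⟨z, hzJ, hza⟩ : ∃ z ∈ J, z ∉ cyl [ω m] := by
    obtain ⟨p, hp, hp'⟩ := not_subset.1 hm'
    obtain ⟨z, hz, rfl⟩ := hm hp
    refine ⟨z, ⟨hz, hp.1⟩, fun hza => hp' ?_⟩
    rw [wordPrefix_succ, cyl_append]
    exact ⟨z, hza, rfl⟩
  have ha : (1 : ℝ) ≤ ω m := by exact_mod_cast h.pos m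
  rcases le_or_gt (1 / (ω m : ℝ) ^ 2) (32 * ρ₀) with hcase | hcase
  · refine ⟨m, min 1 (32 * ρ₀), ?_, min_le_left _ _, ?_, ?_, ?_⟩
    · exact le_min (derivNorm_le_one (posWord_singleton (h.pos m)))
        (by rwa [derivNorm_singleton (h.pos m)])
    · rcases min_choice 1 (32 * ρ₀) with h1 | h1 <;> rw [h1]
      · linarith
      · rw [hrρ]
        have := mul_pos hρ₀ hN
        change _ ≤ 128 * (32 * ρ₀ * N)
        nlinarith
    · have := mul_le_mul_of_nonneg_right (min_le_right 1 (32 * ρ₀)) hN.le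
      change _ * N ≤ _
      nlinarith
    · refine hμJ.trans ?_
      gcongr
      · have h1 : N ^ δ ≤ (4 * N) ^ δ := by
          gcongr
          linarith
        have h2 : 0 ≤ (4 * N) ^ δ := by positivity
        change N ^ δ ≤ 2 * (4 * N) ^ δ
        linarith
      · intro z hz
        refine mem_cthickening_of_dist_le _ (y m) _ _ (h.mem_cyl_singleton m) ?_
        rw [Real.dist_eq]
        have h1 := hJy z hz
        have h2 := hJ01 hz
        have h3 := h.mem_Icc m
        exact le_min (abs_le.2 ⟨by linarith [h2.1, h3.2], by linarith [h2.2, h3.1]⟩) (by linarith)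
  · obtain ⟨c, hc, hcy⟩ : ∃ c, (c = ω m ∨ c = ω m + 1) ∧ |y m - 1 / c| ≤ ρ₀ := by
      have h1 := abs_le.1 (hJy z hzJ)
      have hpos := h.mem_Ioo (m + 1)
      have hstep : y m = 1 / (ω m + y (m + 1)) := h.step m
      have h2 : y m ≤ 1 / ω m := by
        rw [hstep]
        exact one_div_le_one_div_of_le (by linarith) (by linarith [hpos.1])
      have h3 : 1 / ((ω m : ℝ) + 1) ≤ y m := by
        rw [hstep]
        exact one_div_le_one_div_of_le (by linarith [hpos.1]) (by linarith [hpos.2])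
      rcases lt_or_ge (1 / (ω m : ℝ)) z with h4 | h4
      · exact ⟨ω m, Or.inl rfl, abs_le.2 ⟨by linarith, by linarith⟩⟩
      · rcases lt_or_ge z (1 / ((ω m : ℝ) + 1)) with h5 | h5
        · refine ⟨ω m + 1, Or.inr rfl, ?_⟩
          push_cast
          exact abs_le.2 ⟨by linarith, by linarith⟩
        · refine absurd ?_ hza
          have hz0 : 0 < z := lt_of_lt_of_le (by positivity) h5
          refine ⟨1 / z - ω m, ⟨?_, ?_⟩, ?_⟩
          · rw [sub_nonneg, le_div_comm₀ (by linarith) hz0]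
            exact h4
          · rw [sub_le_iff_le_add', div_le_comm₀ hz0 (by linarith)]
            exact h5
          · rw [wordMap_singleton, gaussMap]
            simp
    have hca : (c : ℝ) ≤ 2 * ω m ∧ (1 : ℝ) ≤ c := by
      rcases hc with rfl | rfl
      · exact ⟨by linarith, ha⟩
      · push_cast
        exact ⟨by linarith, by linarith⟩
    have hcn : 1 ≤ c := by exact_mod_cast hca.2
    have hcρ : 8 * (c : ℝ) ^ 2 * ρ₀ ≤ 1 := by
      rw [lt_div_iff₀ (by positivity)] at hcase
      have : (c : ℝ) ^ 2 ≤ (2 * ω m) ^ 2 := by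
        have := hca.1
        gcongr
      nlinarith
    obtain ⟨n, -, hyn, hn1, hn2⟩ := h.exists_tail_near_zero hc hcρ (hcy.trans (by linarith))
    set t := 4 * ρ₀ * (c : ℝ) ^ 2
    have htN : t * (N * (1 / (c : ℝ) ^ 2)) = 16 * r := by
      have : (c : ℝ) ≠ 0 := by linarith [hca.2]
      simp only [t]
      rw [hrρ]
      field_simp
      norm_num
    have ht0 : 0 < t := by
      have := hca.2
      positivity
    have hb : (1 : ℝ) ≤ ω n := by exact_mod_cast h.pos n
    refine ⟨n, 2 * t, ?_, by simp only [t]; linarith, ?_, ?_, ?_⟩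
    · rw [derivNorm_singleton (h.pos n)]
      have hpos := h.mem_Ioo (n + 1)
      have hstep : y n = 1 / (ω n + y (n + 1)) := h.step n
      have h1 : 1 / ((ω n : ℝ) + 1) ≤ t := by
        refine le_trans ?_ hyn
        rw [hstep]
        exact one_div_le_one_div_of_le (by linarith [hpos.1]) (by linarith [hpos.2])
      have h2 : 1 / (ω n : ℝ) ^ 2 ≤ 2 * (1 / ((ω n : ℝ) + 1)) := by
        rw [mul_one_div, div_le_div_iff₀ (by positivity) (by positivity)]
        nlinarith
      linarith
    · have := mul_le_mul_of_nonneg_left hn1 ht0.le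
      nlinarith
    · have := mul_le_mul_of_nonneg_left hn2 ht0.le
      nlinarith
    · have h1 := hμ.measure_near_inv_le hE hδ hcn hcρ hJ01 fun z hz => by
        have h2 := abs_le.1 (hJy z hz)
        have h3 := abs_le.1 hcy
        exact abs_le.2 ⟨by linarith, by linarith⟩
      refine hμJ.trans ((mul_le_mul_right h1 _).trans ?_)
      rw [← mul_assoc, ← ENNReal.ofReal_mul (by positivity)]
      refine mul_le_mul' (ENNReal.ofReal_le_ofReal ?_) (measure_mono ?_)
      · rw [mul_left_comm, ← Real.mul_rpow hN.le (by positivity)]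
        have h2 : N * (1 / (c : ℝ) ^ 2) ≤ 4 * derivNorm (wordPrefix ω n) := by linarith
        gcongr
      · intro z hz
        refine mem_cthickening_of_dist_le _ (y n) _ _ (h.mem_cyl_singleton n) ?_
        rw [Real.dist_eq]
        have h3 := h.mem_Ioo n
        exact abs_le.2 ⟨by linarith [hz.1], by linarith [hz.2, h3.1]⟩

lemma IsDoubling.exists_le_mul {ψ : ℝ → ℝ} (hdim : IsDimFun ψ) (hdbl : IsDoubling ψ) {C₁ : ℝ}
    (hC₁ : 1 ≤ C₁) :
    ∃ C₂ : ℝ, 1 ≤ C₂ ∧ ∀ x y : ℝ, 0 < x → 0 < y → x ≤ C₁ * y → ψ x ≤ C₂ * ψ y := by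
  obtain ⟨C₂, hC₂, h⟩ := hdbl C₁ hC₁
  refine ⟨C₂, hC₂, fun x y hx hy hxy => ?_⟩
  have hψy := hdim.2.2.1 y hy
  rcases le_total x y with hle | hle
  · exact (hdim.2.1 hx hy hle).trans (le_mul_of_one_le_left hψy.le hC₂)
  · rw [← div_le_iff₀ hψy]
    refine (h x y hx hy ?_ ?_).2
    · exact (inv_le_one_of_one_le₀ hC₁).trans ((one_le_div hy).2 hle)
    · rwa [div_le_iff₀ hy]

lemma hausdorffPsi_gauge_le (ψ : ℝ → ℝ) {r : ℝ} (hr : 0 ≤ r) :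
    (if ENNReal.ofReal r = 0 then 0 else ENNReal.ofReal (ψ (ENNReal.ofReal r).toReal)) ≤
      ENNReal.ofReal (ψ r) := by
  split_ifs
  · exact zero_le
  · rw [ENNReal.toReal_ofReal hr]

lemma measure_inter_le_gauge {ψ : ℝ → ℝ} (hdim : IsDimFun ψ) {μ : Measure ℝ} {c : ℝ≥0∞}
    (hc : c ≠ ⊤) {R : ℝ} (hR : 0 < R) {A t : Set ℝ}
    (hA : ∀ x ∈ A, ∀ r ∈ Ioo 0 R, μ (closedBall x r) ≤ c * ENNReal.ofReal (ψ r))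
    (ht : ediam t < ENNReal.ofReal R) :
    μ (A ∩ t) ≤ c * ⨆ _ : t.Nonempty,
      if ediam t = 0 then 0 else ENNReal.ofReal (ψ (ediam t).toReal) := by
  rcases (A ∩ t).eq_empty_or_nonempty with h | ⟨x, hxA, hxt⟩
  · simp [h]
  have hne : ediam t ≠ ⊤ := ht.ne_top
  rw [ciSup_pos ⟨x, hxt⟩]
  split_ifs with h0
  · have h1 : A ∩ t ⊆ {x} := fun z hz => ediam_eq_zero_iff.1 h0 hz.2 hxt
    have h2 : Tendsto (fun r => c * ENNReal.ofReal (ψ r)) (𝓝[>] 0) (𝓝 0) := by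
      have := ENNReal.Tendsto.const_mul (ENNReal.tendsto_ofReal hdim.2.2.2) (Or.inr hc)
      simpa using this
    have h3 : μ {x} ≤ 0 := by
      refine ge_of_tendsto h2 ?_
      filter_upwards [Ioo_mem_nhdsGT hR] with r hr
      exact (measure_mono (by simpa using hr.1.le)).trans (hA x hxA r hr)
    simpa using (measure_mono h1).trans h3
  · have h1 : 0 < (ediam t).toReal := ENNReal.toReal_pos h0 hne
    have h2 : (ediam t).toReal < R := (ENNReal.lt_ofReal_iff_toReal_lt hne).1 ht
    refine (measure_mono ?_).trans (hA x hxA _ ⟨h1, h2⟩)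
    intro z hz
    rw [mem_closedBall, dist_edist]
    exact ENNReal.toReal_mono hne (edist_le_ediam_of_mem hz.2 hxt)

/-- Mass distribution principle. -/
lemma le_hausdorffPsiOf {ψ : ℝ → ℝ} (hdim : IsDimFun ψ) {μ : Measure ℝ} [IsProbabilityMeasure μ]
    {c : ℝ≥0∞} (hc0 : c ≠ 0) (hc : c ≠ ⊤)
    (h : ∀ᵐ x ∂μ, ∃ R > 0, ∀ r ∈ Ioo 0 R, μ (closedBall x r) ≤ c * ENNReal.ofReal (ψ r)) :
    c⁻¹ ≤ hausdorffPsiOf ψ μ := by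
  refine le_iInf fun A => le_iInf fun hA => le_iInf fun hAμ => ?_
  rw [ENNReal.inv_le_iff_le_mul (fun _ => hc0) fun h => absurd h hc]
  set S : ℕ → Set ℝ := fun m =>
    {x ∈ A | ∀ r ∈ Ioo (0 : ℝ) (1 / (m + 1)), μ (closedBall x r) ≤ c * ENNReal.ofReal (ψ r)}
  have hS : Monotone S := by
    rintro m n hmn x ⟨hxA, hx⟩
    refine ⟨hxA, fun r hr => hx r ⟨hr.1, hr.2.trans_le ?_⟩⟩
    gcongr
  have hSU : μ (⋃ m, S m) = 1 := by
    have h1 : (⋃ m, S m) =ᵐ[μ] univ := by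
      have hA' : ∀ᵐ x ∂μ, x ∈ A := hAμ
      refine eventuallyEq_univ.2 ?_
      filter_upwards [h, hA'] with x ⟨R, hR, hx⟩ hxA
      obtain ⟨m, hm⟩ := exists_nat_one_div_lt hR
      exact mem_iUnion.2 ⟨m, hxA, fun r hr => hx r ⟨hr.1, hr.2.trans hm⟩⟩
    rw [measure_congr h1, measure_univ]
  rw [← hSU, hS.measure_iUnion]
  refine iSup_le fun m => ?_
  have hR : (0 : ℝ) < 1 / (m + 1) := by positivity
  have hSA : hausdorffPsi ψ (S m) ≤ hausdorffPsi ψ A := measure_mono fun x hx => hx.1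
  refine le_trans ?_ (mul_le_mul_right hSA c)
  rw [hausdorffPsi, Measure.mkMetric_apply, ENNReal.mul_iSup]
  refine le_iSup_of_le (ENNReal.ofReal (1 / (m + 1) / 2)) ?_
  rw [iSup_pos (by rw [ENNReal.ofReal_pos]; positivity)]
  simp_rw [ENNReal.mul_iInf_of_ne hc0 hc]
  refine le_iInf fun t => le_iInf fun hcov => le_iInf fun hdiam => ?_
  rw [← ENNReal.tsum_mul_left]
  calc μ (S m) ≤ μ (⋃ n, S m ∩ t n) := by
        rw [← inter_iUnion]
        exact measure_mono (subset_inter Subset.rfl hcov)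
    _ ≤ ∑' n, μ (S m ∩ t n) := measure_iUnion_le _
    _ ≤ _ := ENNReal.tsum_le_tsum fun n =>
        measure_inter_le_gauge hdim hc hR (fun x hx => hx.2)
          ((hdiam n).trans_lt ((ENNReal.ofReal_lt_ofReal_iff hR).2 (half_lt_self hR)))

/-- If `μ` has large density along a sequence of scales at almost every point, then the Hausdorff
measure is small on a set of full measure. -/
lemma hausdorffPsiOf_le {ψ : ℝ → ℝ} {μ : Measure ℝ} [IsProbabilityMeasure μ]
    {c : ℝ≥0∞} {K : ℝ} (hK0 : 0 ≤ K)
    (hK : ∀ r, 0 < r → ψ (10 * r) ≤ K * ψ r)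
    (h : ∀ᵐ x ∂μ, ∀ ε > 0, ∃ r ∈ Ioo 0 ε, c * ENNReal.ofReal (ψ r) ≤ μ (closedBall x r)) :
    hausdorffPsiOf ψ μ ≤ ENNReal.ofReal K * c⁻¹ := by
  set G := {x | ∀ ε > 0, ∃ r ∈ Ioo 0 ε, c * ENNReal.ofReal (ψ r) ≤ μ (closedBall x r)}
  have hG : μ Gᶜ = 0 := h
  set A := (toMeasurable μ Gᶜ)ᶜ
  have hAG : A ⊆ G := compl_subset_comm.1 (subset_toMeasurable μ Gᶜ)
  refine iInf_le_of_le A (iInf_le_of_le (measurableSet_toMeasurable _ _).compl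
    (iInf_le_of_le (by rw [compl_compl, measure_toMeasurable, hG]) ?_))
  set T : ℕ → Set (ℝ × ℝ) := fun k =>
    {p | p.1 ∈ A ∧ p.2 ∈ Ioo (0 : ℝ) (1 / (k + 1)) ∧
      c * ENNReal.ofReal (ψ p.2) ≤ μ (closedBall p.1 p.2)}
  have hV := fun k => Vitali.exists_disjoint_subfamily_covering_enlargement_closedBall (T k)
    (fun p => p.1) (fun p => p.2) (1 / (k + 1)) (fun p hp => hp.2.1.2.le) 5 (by norm_num)
  choose u huT hdisj hcov using hV
  have hucount : ∀ k, (u k).Countable := by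
    intro k
    refine (hdisj k).countable_of_nonempty_interior fun p hp => ?_
    exact ⟨p.1, ball_subset_interior_closedBall (mem_ball_self (huT k hp).2.1.1)⟩
  have : ∀ k, Countable (u k) := fun k => (hucount k).to_subtype
  have hsum : ∀ k, ∑' p : u k, ENNReal.ofReal (ψ (p : ℝ × ℝ).2) ≤ c⁻¹ := by
    intro k
    rw [ENNReal.le_inv_iff_mul_le, mul_comm, ← ENNReal.tsum_mul_left]
    refine (ENNReal.tsum_le_tsum fun p => (huT k p.2).2.2).trans ?_
    rw [← measure_biUnion (hucount k) (hdisj k) fun p _ => measurableSet_closedBall]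
    exact prob_le_one
  have hdiam : ∀ (x : ℝ) {r : ℝ}, ediam (closedBall x (5 * r)) = ENNReal.ofReal (10 * r) := by
    intro x r
    rw [Real.closedBall_eq_Icc, Real.ediam_Icc]
    congr 1
    ring
  have hlim : Tendsto (fun k : ℕ => ENNReal.ofReal (10 * (1 / ((k : ℝ) + 1)))) atTop (𝓝 0) := by
    have := ENNReal.tendsto_ofReal ((tendsto_one_div_add_atTop_nhds_zero_nat (𝕜 := ℝ)).const_mul 10)
    simpa using this
  refine (Measure.mkMetric_le_liminf_tsum A _ hlim
    (fun k (p : u k) => closedBall (p : ℝ × ℝ).1 (5 * (p : ℝ × ℝ).2)) ?_ ?_ _).trans ?_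
  · refine Eventually.of_forall fun k p => ?_
    rw [hdiam]
    have := (huT k p.2).2.1.2
    gcongr
  · refine Eventually.of_forall fun k x hx => ?_
    obtain ⟨r, hr, hrx⟩ := hAG hx (1 / (k + 1)) (by positivity)
    obtain ⟨p, hp, hsub⟩ := hcov k (x, r) ⟨hx, hr, hrx⟩
    exact mem_iUnion.2 ⟨⟨p, hp⟩, hsub (mem_closedBall_self hr.1.le)⟩
  · refine liminf_le_of_le (by isBoundedDefault) fun b hb => ?_
    obtain ⟨k, hk⟩ := hb.exists
    refine hk.trans ?_
    calc _ ≤ ∑' p : u k, ENNReal.ofReal K * ENNReal.ofReal (ψ (p : ℝ × ℝ).2) := by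
          refine ENNReal.tsum_le_tsum fun p => ?_
          have hp := (huT k p.2).2.1.1
          rw [hdiam]
          refine (hausdorffPsi_gauge_le ψ (by positivity)).trans ?_
          rw [← ENNReal.ofReal_mul hK0]
          exact ENNReal.ofReal_le_ofReal (hK _ hp)
      _ ≤ _ := by
          rw [ENNReal.tsum_mul_left]
          gcongr
          exact hsum k

lemma tsum_comp_div (g : ℕ → ℝ≥0∞) {p : ℕ} (hp : 1 ≤ p) :
    ∑' n, g (n / p) = p * ∑' n, g n := by
  have : NeZero p := ⟨by omega⟩
  have h1 : ∑' n, g (n / p) = ∑' q : ℕ × Fin p, g q.1 :=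
    (Nat.divModEquiv p).tsum_eq (fun q : ℕ × Fin p => g q.1)
  rw [h1, ENNReal.tsum_prod (f := fun n _ => g n)]
  simp [tsum_fintype, ENNReal.tsum_mul_left]

lemma JsetH_subset (E : Set ℕ) (δ : ℝ) (μ : Measure ℝ) (Ψ : ℝ → ℝ) (lam : ℝ) (k : ℕ) (α : ℝ) :
    JsetH E δ μ Ψ lam k α ⊆ E := fun _ ha => ha.1

lemma cylMass_mono (μ : Measure ℝ) {J K : Set ℕ} (h : J ⊆ K) : cylMass μ J ≤ cylMass μ K :=
  ENNReal.tsum_mono_subtype (fun a => μ (cyl [a])) h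

lemma JsetH_antitone {E : Set ℕ} (hE : 0 ∉ E) {δ : ℝ} {μ : Measure ℝ} {Ψ : ℝ → ℝ}
    (hmono : AntitoneOn Ψ (Ioi 0)) {lam : ℝ} (hlam : 1 < lam) {α : ℝ} (hα : 0 < α) :
    Antitone fun k => JsetH E δ μ Ψ lam k α := by
  rintro j k hjk a ⟨ha, ρ, h1, h2, h3⟩
  refine ⟨ha, ρ, h1, h2, le_trans (ENNReal.ofReal_le_ofReal ?_) h3⟩
  have hρ : 0 < ρ := (derivNorm_pos (posWord_singleton (ne_zero_of_mem hE ha))).trans_le h1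
  have hl : 0 < lam := by linarith
  have hle : Ψ (lam ^ (-(j : ℝ)) * ρ) ≤ Ψ (lam ^ (-(k : ℝ)) * ρ) := by
    refine hmono ?_ ?_ ?_
    · exact mem_Ioi.2 (by positivity)
    · exact mem_Ioi.2 (by positivity)
    · have : lam ^ (-(k : ℝ)) ≤ lam ^ (-(j : ℝ)) :=
        Real.rpow_le_rpow_of_exponent_le hlam.le (by simpa using hjk)
      gcongr
  gcongr

namespace IsConformal

variable {E : Set ℕ} {δ : ℝ} {μ : Measure ℝ} {ψ Ψ : ℝ → ℝ} {lam : ℝ}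

lemma exists_ae_measure_closedBall_le (hμ : IsConformal E δ μ) (hE : 0 ∉ E) (hδ : 0 ≤ δ)
    (hdim : IsDimFun ψ) (hdbl : IsDoubling ψ) (hΨ : ∀ r, 0 < r → r ^ δ * Ψ r = ψ r)
    (hmono : AntitoneOn Ψ (Ioi 0)) (hlam : 1 < lam) :
    ∃ C > 0, ∀ α > 0, ∑' k, cylMass μ (JsetH E δ μ Ψ lam k α) ≠ ⊤ →
      ∀ᵐ x ∂μ, ∃ R > 0, ∀ r ∈ Ioo 0 R,
        μ (closedBall x r) ≤ ENNReal.ofReal (C * α) * ENNReal.ofReal (ψ r) := by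
  obtain ⟨C₂, hC₂, hψ⟩ := IsDoubling.exists_le_mul hdim hdbl (C₁ := 128) (by norm_num)
  have hC₂0 : 0 < C₂ := by linarith
  have hl0 : 0 < lam := by linarith
  refine ⟨2 * 4 ^ δ * C₂, by positivity, fun α hα hsum => ?_⟩
  obtain ⟨p, hp⟩ := pow_unbounded_of_one_lt lam (one_lt_two (α := ℝ))
  have hp1 : 1 ≤ p := by
    by_contra! h0
    obtain rfl : p = 0 := by omega
    simp only [pow_zero] at hp
    linarith
  have hJsum : ∑' n, cylMass μ (JsetH E δ μ Ψ lam ((n - 1) / p) α) ≠ ⊤ := by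
    rw [tsum_eq_zero_add' ENNReal.summable]
    simp only [Nat.add_sub_cancel]
    rw [tsum_comp_div (fun k => cylMass μ (JsetH E δ μ Ψ lam k α)) hp1]
    refine ENNReal.add_ne_top.2 ⟨?_, ENNReal.mul_ne_top (ENNReal.natCast_ne_top p) hsum⟩
    exact ne_top_of_le_ne_top ENNReal.one_ne_top
      (hμ.cylMass_le_one hE hδ (JsetH_subset E δ μ Ψ lam _ α))
  filter_upwards [hμ.ae_eventually_letter_notMem hE hδ (fun n => JsetH_subset E δ μ Ψ lam _ α) hJsum,
    hμ.ae_exists_isCoding hE] with x hx hcod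
  obtain ⟨ω, y, h, rfl⟩ := hcod
  obtain ⟨n₀, hn₀⟩ := eventually_atTop.1 ((hx ω y h rfl).and (eventually_ge_atTop 1))
  have hN0 := derivNorm_pos (h.posWord n₀)
  refine ⟨min (1 / 2) (derivNorm (wordPrefix ω n₀) / 128), by positivity, fun r hr => ?_⟩
  obtain ⟨n, ρ, hρ, hρ1, hr1, hr2, hball⟩ := hμ.exists_measure_closedBall_le hE hδ h hr.1
    (hr.2.le.trans (min_le_left _ _))
  have hn : n₀ ≤ n := by
    by_contra! hlt
    have h1 : derivNorm (wordPrefix ω n₀) ≤ derivNorm (wordPrefix ω (n + 1)) :=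
      h.derivNorm_antitone hlt
    have h2 : derivNorm (wordPrefix ω (n + 1)) ≤ derivNorm (wordPrefix ω n) * derivNorm [ω n] := by
      rw [wordPrefix_succ]
      exact derivNorm_append_le (h.posWord n) (posWord_singleton (h.pos n))
    have h3 : derivNorm (wordPrefix ω n) * derivNorm [ω n] ≤ derivNorm (wordPrefix ω n) * ρ :=
      mul_le_mul_of_nonneg_left hρ (derivNorm_pos (h.posWord n)).le
    have h4 := hr.2.trans_le (min_le_right _ _)
    rw [lt_div_iff₀ (by norm_num)] at h4
    linarith
  obtain ⟨hnJ, hn1⟩ := hn₀ n hn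
  set N := derivNorm (wordPrefix ω n)
  have hN : 0 < N := derivNorm_pos (h.posWord n)
  have hρ0 : 0 < ρ := (derivNorm_pos (posWord_singleton (h.pos n))).trans_le hρ
  have hlt := lt_of_not_ge fun hge => hnJ ⟨h.mem n, ρ, hρ, hρ1, hge⟩
  set k := (n - 1) / p
  have hNk : N ≤ lam ^ (-(k : ℝ)) := by
    have h1 : lam ^ k ≤ 2 ^ (n - 1) :=
      calc lam ^ k ≤ (2 ^ p) ^ k := by gcongr
        _ = 2 ^ (p * k) := (pow_mul _ _ _).symm
        _ ≤ 2 ^ (n - 1) := pow_le_pow_right₀ one_le_two (Nat.mul_div_le _ _)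
    rw [Real.rpow_neg hl0.le, Real.rpow_natCast]
    refine (h.derivNorm_le n).trans ?_
    rw [le_inv_comm₀ (by positivity) (by positivity)]
    refine h1.trans_eq ?_
    obtain ⟨m, rfl⟩ : ∃ m, n = m + 1 := ⟨n - 1, by omega⟩
    simp only [Nat.add_sub_cancel, pow_succ, one_div, inv_pow]
    field_simp
  have hΨle : Ψ (lam ^ (-(k : ℝ)) * ρ) ≤ Ψ (ρ * N) := by
    refine hmono (mem_Ioi.2 (by positivity)) (mem_Ioi.2 (by positivity)) ?_
    rw [mul_comm]
    gcongr
  calc μ (closedBall (y 0) r)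
      ≤ ENNReal.ofReal (2 * (4 * N) ^ δ) * ENNReal.ofReal (α * ρ ^ δ * Ψ (ρ * N)) := by
        refine hball.trans ?_
        gcongr
        refine hlt.le.trans (ENNReal.ofReal_le_ofReal ?_)
        gcongr
    _ = ENNReal.ofReal (2 * 4 ^ δ * α * ψ (ρ * N)) := by
        rw [← ENNReal.ofReal_mul (by positivity), ← hΨ _ (by positivity),
          Real.mul_rpow (by norm_num) hN.le, Real.mul_rpow hρ0.le hN.le]
        congr 1
        ring
    _ ≤ ENNReal.ofReal (2 * 4 ^ δ * α * (C₂ * ψ r)) := by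
        have := hψ _ _ (mul_pos hρ0 hN) hr.1 hr2
        gcongr
    _ = _ := by
        rw [← ENNReal.ofReal_mul (by positivity)]
        congr 1
        ring

lemma exists_ae_le_measure_closedBall (hμ : IsConformal E δ μ) (hE : 0 ∉ E) (hδ : 0 ≤ δ)
    (hdim : IsDimFun ψ) (hdbl : IsDoubling ψ) (hΨ : ∀ r, 0 < r → r ^ δ * Ψ r = ψ r)
    (hmono : AntitoneOn Ψ (Ioi 0)) (hlam : 1 < lam) {θ : ℝ} (hθ : 0 ≤ θ) (hθδ : θ < δ)
    (hθsum : ∑' a : E, ENNReal.ofReal (derivNorm [(a : ℕ)] ^ θ) ≠ ⊤) :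
    ∃ c > 0, ∀ α > 0, ∑' k, cylMass μ (JsetH E δ μ Ψ lam k α) = ⊤ →
      ∀ᵐ x ∂μ, ∀ ε > 0, ∃ r ∈ Ioo 0 ε,
        ENNReal.ofReal (c * α) * ENNReal.ofReal (ψ r) ≤ μ (closedBall x r) := by
  obtain ⟨C₂, hC₂, hψ⟩ := IsDoubling.exists_le_mul hdim hdbl (C₁ := 2) (by norm_num)
  have hC₂0 : 0 < C₂ := by linarith
  have hl0 : 0 < lam := by linarith
  refine ⟨(4 ^ δ)⁻¹ * C₂⁻¹, by positivity, fun α hα hsum => ?_⟩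
  obtain ⟨L, hL, hae⟩ := hμ.ae_eventually_le_derivNorm hE hδ hθ hθδ hθsum hlam
  have hJsum : ∑' n, cylMass μ (JsetH E δ μ Ψ lam (L * n) α) = ⊤ := by
    by_contra hne
    have h1 : ∑' k, cylMass μ (JsetH E δ μ Ψ lam k α) ≤
        ∑' k, cylMass μ (JsetH E δ μ Ψ lam (L * (k / L)) α) :=
      ENNReal.tsum_le_tsum fun k =>
        cylMass_mono μ (JsetH_antitone hE hmono hlam hα (Nat.mul_div_le _ _))
    rw [hsum, tsum_comp_div (fun n => cylMass μ (JsetH E δ μ Ψ lam (L * n) α)) hL] at h1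
    exact ENNReal.mul_ne_top (ENNReal.natCast_ne_top L) hne (top_le_iff.1 h1)
  filter_upwards [hμ.ae_frequently_letter_mem hE hδ (fun n => JsetH_subset E δ μ Ψ lam _ α) hJsum,
    hae, hμ.ae_exists_isCoding hE] with x hx hx' hcod ε hε
  obtain ⟨ω, y, h, rfl⟩ := hcod
  have hsmall : ∀ᶠ n in atTop, derivNorm (wordPrefix ω n) < ε / 2 :=
    h.tendsto_derivNorm.eventually_lt_const (by positivity)
  obtain ⟨n, ⟨-, ρ, hρ, hρ1, hle⟩, hNl, hNε⟩ :=
    ((hx ω y h rfl).and_eventually ((hx' ω y h rfl).and hsmall)).exists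
  set N := derivNorm (wordPrefix ω n)
  have hN : 0 < N := derivNorm_pos (h.posWord n)
  have hω := posWord_singleton (h.pos n)
  have hρ0 : 0 < ρ := (derivNorm_pos hω).trans_le hρ
  refine ⟨2 * (ρ * N), ⟨by positivity, by nlinarith⟩, ?_⟩
  have hΨle : Ψ (ρ * N) ≤ Ψ (lam ^ (-((L * n : ℕ) : ℝ)) * ρ) := by
    refine hmono (mem_Ioi.2 (by positivity)) (mem_Ioi.2 (by positivity)) ?_
    rw [mul_comm, Real.rpow_neg hl0.le, Real.rpow_natCast, ← inv_pow]
    gcongr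
  set B := cthickening ρ (cyl [ω n]) ∩ Icc 0 1
  have hB : MeasurableSet B := isClosed_cthickening.measurableSet.inter measurableSet_Icc
  have hsub : wordMap (wordPrefix ω n) '' B ⊆ closedBall (y 0) (2 * (ρ * N)) := by
    rintro _ ⟨z, ⟨hz, hz1⟩, rfl⟩
    have hcpt : IsCompact (cyl [ω n]) := isCompact_Icc.image_of_continuousOn (continuousOn_wordMap hω)
    rw [hcpt.cthickening_eq_biUnion_closedBall hρ0.le] at hz
    obtain ⟨_, ⟨v, hv, rfl⟩, hzv⟩ := mem_iUnion₂.1 hz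
    obtain ⟨w, hw, hwy⟩ := h.mem_cyl_singleton n
    have h1 : |wordMap [ω n] v - y n| ≤ ρ := by
      rw [← hwy]
      refine (abs_wordMap_sub_le hω hv hw).trans ?_
      have h2 : |v - w| ≤ 1 := by
        rw [abs_le]
        constructor <;> linarith [hv.1, hv.2, hw.1, hw.2]
      nlinarith [derivNorm_pos hω, abs_nonneg (v - w)]
    have h2 : |z - y n| ≤ 2 * ρ := by
      rw [mem_closedBall, Real.dist_eq] at hzv
      linarith [abs_sub_le z (wordMap [ω n] v) (y n)]
    rw [mem_closedBall, Real.dist_eq, h.eq_wordMap n]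
    refine (abs_wordMap_sub_le (h.posWord n) hz1 (h.mem_Icc n)).trans ?_
    calc N * |z - y n| ≤ N * (2 * ρ) := by gcongr
      _ = _ := by ring
  have hψ2 := hψ _ _ (by positivity) (mul_pos hρ0 hN) (le_refl (2 * (ρ * N)))
  calc ENNReal.ofReal ((4 ^ δ)⁻¹ * C₂⁻¹ * α) * ENNReal.ofReal (ψ (2 * (ρ * N)))
      ≤ ENNReal.ofReal ((4 ^ δ)⁻¹ * C₂⁻¹ * α) * ENNReal.ofReal (C₂ * ψ (ρ * N)) := by
        gcongr
    _ = ENNReal.ofReal ((N / 4) ^ δ) * ENNReal.ofReal (α * ρ ^ δ * Ψ (ρ * N)) := by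
        rw [← ENNReal.ofReal_mul (by positivity), ← ENNReal.ofReal_mul (by positivity),
          ← hΨ _ (by positivity), Real.div_rpow hN.le (by norm_num), Real.mul_rpow hρ0.le hN.le]
        congr 1
        field_simp
    _ ≤ ENNReal.ofReal ((N / 4) ^ δ) * μ B := by
        rw [hμ.measure_inter_Icc hE]
        gcongr
        refine le_trans (ENNReal.ofReal_le_ofReal ?_) hle
        gcongr
    _ ≤ μ (wordMap (wordPrefix ω n) '' B) :=
        hμ.le_measure_image hE hδ (h.mem_words n) hB inter_subset_right
    _ ≤ μ (closedBall (y 0) (2 * (ρ * N))) := measure_mono hsub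

end IsConformal

/-- Lemma, Hausdorff case. For a regular Gauss IFS satisfying Assumptions
1, C, 3, and a doubling dimension function `ψ` with `Ψ(r) = r^{-δ} ψ(r)` decreasing: if
`∑_k μ(J_{k,α,1})` converges for all `α > 0` then `H^ψ(μ) = ∞`; if it diverges for all
`α > 0` then `H^ψ(μ) = 0`; otherwise `H^ψ(μ)` is positive and finite. -/
theorem stmt12 (E : Set ℕ) (hE : 0 ∉ E) (δ : ℝ) (hδ : 0 ≤ δ) (hpress : pressure E δ = 0)
    (μ : Measure ℝ) (hμ : IsConformal E δ μ)
    (f : ℝ → ℝ) (s : ℝ) (hs : δ < s ∧ s < 2 * δ) (hreg : RegVarying f s)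
    (h1 : Assumption1 E f)
    (lam : ℝ) (hlam : 1 < lam) (hC : AssumptionC E μ lam)
    (h3 : Assumption3 E μ)
    (ψ : ℝ → ℝ) (hdim : IsDimFun ψ) (hdbl : IsDoubling ψ)
    (Ψ : ℝ → ℝ) (hΨ : Ψ = fun r : ℝ => r ^ (-δ) * ψ r) (hmono : AntitoneOn Ψ (Ioi 0)) :
    ((∀ α : ℝ, 0 < α → (∑' k : ℕ, cylMass μ (JsetH E δ μ Ψ lam k α)) ≠ ⊤) →
        hausdorffPsiOf ψ μ = ⊤) ∧
      ((∀ α : ℝ, 0 < α → (∑' k : ℕ, cylMass μ (JsetH E δ μ Ψ lam k α)) = ⊤) →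
        hausdorffPsiOf ψ μ = 0) ∧
      (((∃ α : ℝ, 0 < α ∧ (∑' k : ℕ, cylMass μ (JsetH E δ μ Ψ lam k α)) ≠ ⊤) ∧
          (∃ α : ℝ, 0 < α ∧ (∑' k : ℕ, cylMass μ (JsetH E δ μ Ψ lam k α)) = ⊤)) →
        0 < hausdorffPsiOf ψ μ ∧ hausdorffPsiOf ψ μ < ⊤) := by
  have hδ0 : 0 < δ := by linarith [hs.1, hs.2]
  have hΨ' : ∀ r, 0 < r → r ^ δ * Ψ r = ψ r := by
    intro r hr
    simp only [hΨ]
    rw [Real.rpow_neg hr.le, mul_inv_cancel_left₀ (Real.rpow_pos_of_pos hr δ).ne']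
  have := hμ.1
  obtain ⟨C, hC0, hupper⟩ := hμ.exists_ae_measure_closedBall_le hE hδ hdim hdbl hΨ' hmono hlam
  obtain ⟨c, hc0, hlower⟩ := hμ.exists_ae_le_measure_closedBall hE hδ hdim hdbl hΨ' hmono hlam
    (θ := (2 * δ + s) / 4) (by linarith [hs.1]) (by linarith [hs.2])
    (h1.tsum_derivNorm_ne_top hE hreg (by linarith [hs.1]) (by linarith [hs.2]))
  obtain ⟨K, hK, hψ⟩ := IsDoubling.exists_le_mul hdim hdbl (C₁ := 10) (by norm_num)
  have hge : ∀ α > 0, ∑' k, cylMass μ (JsetH E δ μ Ψ lam k α) ≠ ⊤ →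
      (ENNReal.ofReal (C * α))⁻¹ ≤ hausdorffPsiOf ψ μ := fun α hα hsum =>
    le_hausdorffPsiOf hdim (ENNReal.ofReal_pos.2 (by positivity)).ne' ENNReal.ofReal_ne_top
      (hupper α hα hsum)
  have hle : ∀ α > 0, ∑' k, cylMass μ (JsetH E δ μ Ψ lam k α) = ⊤ →
      hausdorffPsiOf ψ μ ≤ ENNReal.ofReal K * (ENNReal.ofReal (c * α))⁻¹ := fun α hα hsum =>
    hausdorffPsiOf_le (by linarith) (fun r hr => hψ _ _ (by positivity) hr le_rfl)
      (hlower α hα hsum)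
  refine ⟨fun h => ?_, fun h => ?_, ?_⟩
  · have hlim : Tendsto (fun α => (ENNReal.ofReal (C * α))⁻¹) (𝓝[>] 0) (𝓝 ⊤) := by
      have h0 : Tendsto (fun α => ENNReal.ofReal (C * α)) (𝓝 0) (𝓝 0) := by
        have := ENNReal.tendsto_ofReal ((tendsto_id (α := ℝ) (x := 𝓝 0)).const_mul C)
        simpa using this
      simpa using (h0.mono_left nhdsWithin_le_nhds).inv
    refine top_le_iff.1 (le_of_tendsto hlim ?_)
    filter_upwards [self_mem_nhdsWithin] with α hα using hge α hα (h α hα)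
  · have hlim : Tendsto (fun α => ENNReal.ofReal K * (ENNReal.ofReal (c * α))⁻¹) atTop (𝓝 0) := by
      have h0 : Tendsto (fun α => ENNReal.ofReal (c * α)) atTop (𝓝 ⊤) :=
        ENNReal.tendsto_ofReal_atTop.comp (tendsto_id.const_mul_atTop hc0)
      have := ENNReal.Tendsto.const_mul h0.inv (Or.inr (ENNReal.ofReal_ne_top (r := K)))
      simpa using this
    refine nonpos_iff_eq_zero.1 (ge_of_tendsto hlim ?_)
    filter_upwards [eventually_gt_atTop 0] with α hα using hle α hα (h α hα)
  · rintro ⟨⟨α, hα, hsum⟩, β, hβ, hsum'⟩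
    refine ⟨(ENNReal.inv_pos.2 ENNReal.ofReal_ne_top).trans_le (hge α hα hsum),
      (hle β hβ hsum').trans_lt (ENNReal.mul_lt_top ENNReal.ofReal_lt_top ?_)⟩
    rw [ENNReal.inv_lt_top, ENNReal.ofReal_pos]
    positivity

end
end

section
/- For every δ ∈ (0,1) there exists a constant C > 0 such that for all primes a and all real x with 1 ≤ x ≤ a/3, the number of primes in the interval [a−x, a+x] satisfies #(P ∩ [a−x, a+x]) ≤ C · (x/a)^δ · a/log(a). -/
open MeasureTheory Metric Filter Set
open scoped ENNReal Topology NNReal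

noncomputable section

/-- The primes in `(n, n + h]` exceeding `h` all divide `(n + h).choose h`. -/
lemma pow_card_primes_le_choose (n h : ℕ) (hn : h ≤ n) :
    n ^ ((Finset.Ioc n (n + h)).filter Nat.Prime).card ≤ (n + h).choose h := by
  have hdvd : ∏ p ∈ (Finset.Ioc n (n + h)).filter Nat.Prime, p ∣ (n + h).choose h := by
    refine Finset.prod_primes_dvd _ (fun p hp => (Finset.mem_filter.1 hp).2.prime) ?_
    intro p hp
    obtain ⟨hp, hprime⟩ := Finset.mem_filter.1 hp
    obtain ⟨hnp, hph⟩ := Finset.mem_Ioc.1 hp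
    exact hprime.dvd_choose (by omega) (by omega) hph
  calc n ^ ((Finset.Ioc n (n + h)).filter Nat.Prime).card
      ≤ ∏ p ∈ (Finset.Ioc n (n + h)).filter Nat.Prime, p :=
        Finset.pow_card_le_prod _ _ _ fun p hp =>
          (Finset.mem_Ioc.1 (Finset.mem_filter.1 hp).1).1.le
    _ ≤ _ := Nat.le_of_dvd (Nat.choose_pos (by omega)) hdvd

lemma log_choose_le (N h : ℕ) (hh : 0 < h) (hN : h ≤ N) :
    Real.log (N.choose h) ≤ h * (1 + Real.log (N / h)) := by
  have hh' : (0 : ℝ) < h := by exact_mod_cast hh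
  have hN' : (0 : ℝ) < N := by exact_mod_cast hh.trans_le hN
  have hf : (0 : ℝ) < h.factorial := by exact_mod_cast h.factorial_pos
  have h1 : (N.choose h : ℝ) ≤ (N : ℝ) ^ h / h.factorial := Nat.choose_le_pow_div h N
  have h2 : (h : ℝ) ^ h / h.factorial ≤ Real.exp h := Real.pow_div_factorial_le_exp _ hh'.le h
  have h3 : (N : ℝ) ^ h / h.factorial = (N / h) ^ h * ((h : ℝ) ^ h / h.factorial) := by
    rw [div_pow]; field_simp
  have h4 : (N.choose h : ℝ) ≤ (N / h) ^ h * Real.exp h := by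
    rw [h3] at h1
    exact h1.trans (by gcongr)
  have hc : (0 : ℝ) < N.choose h := by exact_mod_cast Nat.choose_pos hN
  calc Real.log (N.choose h) ≤ Real.log ((N / h) ^ h * Real.exp h) := Real.log_le_log hc h4
    _ = h * (1 + Real.log (N / h)) := by
      rw [Real.log_mul (by positivity) (by positivity), Real.log_pow, Real.log_exp]; ring

lemma card_primes_Ioc_mul_log_le (a k : ℕ) (hk : 0 < k) (hka : 3 * k ≤ a) :
    (((Finset.Ioc (a - k) (a + k)).filter Nat.Prime).card : ℝ) * Real.log a ≤
      4 * k * Real.log (2 * (a / k)) := by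
  have hk' : (0 : ℝ) < k := by exact_mod_cast hk
  have hka' : 3 * (k : ℝ) ≤ a := by exact_mod_cast hka
  have hk1 : (1 : ℝ) ≤ k := by exact_mod_cast hk
  have ha : (0 : ℝ) < a := by linarith
  have hend : a - k + 2 * k = a + k := by omega
  have hsub : ((a - k : ℕ) : ℝ) = a - k := Nat.cast_sub (by omega)
  have hpow := pow_card_primes_le_choose (a - k) (2 * k) (by omega)
  rw [hend] at hpow
  set c := ((Finset.Ioc (a - k) (a + k)).filter Nat.Prime).card
  have hlog : (c : ℝ) * Real.log (a - k) ≤ Real.log ((a + k).choose (2 * k)) := by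
    rw [← Real.log_pow, ← hsub]
    refine Real.log_le_log ?_ (by exact_mod_cast hpow)
    rw [hsub]
    exact pow_pos (by linarith) c
  have hchoose := log_choose_le (a + k) (2 * k) (by omega) (by omega)
  push_cast at hchoose
  have hhalf : Real.log a ≤ 2 * Real.log (a - k) := by
    rw [show 2 * Real.log (a - k : ℝ) = Real.log ((a - k : ℝ) ^ 2) by rw [Real.log_pow]; norm_num]
    exact Real.log_le_log ha (by nlinarith)
  have hratio : 1 + Real.log (((a : ℝ) + k) / (2 * k)) ≤ Real.log (2 * (a / k)) := by
    rw [← Real.log_exp 1, ← Real.log_mul (by positivity) (by positivity)]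
    refine Real.log_le_log (by positivity) ?_
    have he := Real.exp_one_lt_d9
    rw [← mul_div_assoc, ← mul_div_assoc, div_le_div_iff₀ (by positivity) hk']
    have : Real.exp 1 * (a + k) ≤ 4 * a := by nlinarith
    nlinarith
  have hc : (0 : ℝ) ≤ c := Nat.cast_nonneg c
  nlinarith [mul_le_mul_of_nonneg_left hhalf hc, mul_le_mul_of_nonneg_left hratio hk'.le]

lemma card_primes_Icc_le (a k : ℕ) (hka : k ≤ a) :
    ((Finset.Icc (a - k) (a + k)).filter Nat.Prime).card ≤
      ((Finset.Ioc (a - k) (a + k)).filter Nat.Prime).card + 1 := by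
  rw [← Finset.Ioc_insert_left (by omega), Finset.filter_insert]
  split_ifs
  · exact Finset.card_insert_le _ _
  · omega

lemma setOf_primes_abs_sub_le_eq (a : ℕ) (x : ℝ) (hx : 0 ≤ x) :
    {p ∈ primes | |(p : ℝ) - (a : ℝ)| ≤ x} =
      ((Finset.Icc (a - ⌊x⌋₊) (a + ⌊x⌋₊)).filter Nat.Prime : Finset ℕ) := by
  ext p
  have hdist : |(p : ℝ) - a| ≤ x ↔ a - ⌊x⌋₊ ≤ p ∧ p ≤ a + ⌊x⌋₊ := by
    rw [show |(p : ℝ) - a| = ((p - a : ℤ).natAbs : ℝ) by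
      rw [Nat.cast_natAbs]; push_cast; rfl, ← Nat.le_floor_iff hx]
    omega
  simp only [primes, Set.mem_ofPred_eq, hdist, Finset.coe_filter, Finset.mem_Icc]
  exact and_comm

/-- prime-counting upper bound. For every `δ ∈ (0,1)` there is `C > 0`
such that for all primes `a` and all `1 ≤ x ≤ a/3`,
`#(P ∩ [a-x, a+x]) ≤ C (x/a)^δ a/log a`. -/
theorem stmt17 (δ : ℝ) (hδ₀ : 0 < δ) (hδ₁ : δ < 1) :
    ∃ C : ℝ, 0 < C ∧ ∀ a : ℕ, a.Prime → ∀ x : ℝ, 1 ≤ x → x ≤ (a : ℝ) / 3 →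
      (({p ∈ primes | |(p : ℝ) - (a : ℝ)| ≤ x}.ncard : ℝ)) ≤
        C * (x / (a : ℝ)) ^ δ * ((a : ℝ) / Real.log (a : ℝ)) := by
  have hε : 0 < 1 - δ := by linarith
  refine ⟨9 / (1 - δ), by positivity, ?_⟩
  intro a _ x hx hxa
  have hkpos : 0 < ⌊x⌋₊ := Nat.floor_pos.2 hx
  have hkx : (⌊x⌋₊ : ℝ) ≤ x := Nat.floor_le (by linarith)
  rw [setOf_primes_abs_sub_le_eq a x (by linarith), Set.ncard_coe_finset]
  set k := ⌊x⌋₊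
  have hk : (1 : ℝ) ≤ k := by exact_mod_cast hkpos
  have hk0 : (0 : ℝ) < k := by linarith
  have ha : (3 : ℝ) ≤ a := by linarith
  have ha0 : (0 : ℝ) < a := by linarith
  have hka : 3 * k ≤ a := by
    have : 3 * (k : ℝ) ≤ a := by linarith
    exact_mod_cast this
  have hloga : 0 < Real.log a := Real.log_pos (by linarith)
  have hcard : (((Finset.Icc (a - k) (a + k)).filter Nat.Prime).card : ℝ) ≤
      (((Finset.Ioc (a - k) (a + k)).filter Nat.Prime).card : ℝ) + 1 := by
    exact_mod_cast card_primes_Icc_le a k (by omega)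
  have hIoc := card_primes_Ioc_mul_log_le a k hkpos hka
  have hsplit (y : ℝ) (hy : 0 < y) : (y / a) ^ δ * a = y ^ δ * (a : ℝ) ^ (1 - δ) := by
    rw [Real.div_rpow hy.le ha0.le, Real.rpow_sub ha0, Real.rpow_one]; ring
  have hlogt : Real.log (2 * (a / k)) ≤ 2 * (a / k : ℝ) ^ (1 - δ) / (1 - δ) := by
    refine (Real.log_le_rpow_div (by positivity) hε).trans ?_
    rw [Real.mul_rpow (by norm_num) (by positivity)]
    gcongr
    calc (2 : ℝ) ^ (1 - δ) ≤ 2 ^ (1 : ℝ) :=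
          Real.rpow_le_rpow_of_exponent_le (by norm_num) (by linarith)
      _ = 2 := Real.rpow_one 2
  have hmain : k * (a / k : ℝ) ^ (1 - δ) = (k : ℝ) ^ δ * (a : ℝ) ^ (1 - δ) := by
    rw [Real.div_rpow ha0.le hk0.le, Real.rpow_sub hk0, Real.rpow_one]
    field_simp
  have hone : Real.log a ≤ (k : ℝ) ^ δ * (a : ℝ) ^ (1 - δ) / (1 - δ) := by
    refine (Real.log_le_rpow_div ha0.le hε).trans ?_
    gcongr
    exact le_mul_of_one_le_left (by positivity) (Real.one_le_rpow hk hδ₀.le)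
  have hkδ : (k : ℝ) ^ δ ≤ x ^ δ := Real.rpow_le_rpow hk0.le hkx hδ₀.le
  rw [← mul_div_assoc, le_div_iff₀ hloga, mul_assoc, hsplit x (by linarith)]
  calc (((Finset.Icc (a - k) (a + k)).filter Nat.Prime).card : ℝ) * Real.log a
      ≤ (((Finset.Ioc (a - k) (a + k)).filter Nat.Prime).card + 1) * Real.log a := by gcongr
    _ ≤ 4 * k * Real.log (2 * (a / k)) + Real.log a := by linarith
    _ ≤ 4 * k * (2 * (a / k : ℝ) ^ (1 - δ) / (1 - δ)) +
          (k : ℝ) ^ δ * (a : ℝ) ^ (1 - δ) / (1 - δ) := by gcongr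
    _ = 8 / (1 - δ) * (k * (a / k : ℝ) ^ (1 - δ)) +
          (k : ℝ) ^ δ * (a : ℝ) ^ (1 - δ) / (1 - δ) := by ring
    _ = 9 / (1 - δ) * ((k : ℝ) ^ δ * (a : ℝ) ^ (1 - δ)) := by rw [hmain]; ring
    _ ≤ 9 / (1 - δ) * (x ^ δ * (a : ℝ) ^ (1 - δ)) := by gcongr
end
end
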